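/- Let T be an m-dimensional torus acting continuously and effectively on a connected topological n-manifold X. Then m ≤ n. -/

import Mathlib

open MeasureTheory Metric Set Polynomial Filter Topology
open scoped ContDiff

theorem exists_weights_det_one_add {E : Type*} [NormedAddCommGroup E] [NormedSpace ℝ E]
    [FiniteDimensional ℝ E] (s : Finset ℝ) (hs : s.card = Module.finrank ℝ E + 1) :
    ∃ w : ℝ → ℝ, ∑ t ∈ s, w t = 1 ∧ ∀ A : E →L[ℝ] E,
        (1 + A).det = ∑ t ∈ s, w t * (1 + t • A).det := by
  classical
  refine ⟨fun t => (Lagrange.basis s id t).eval 1, ?_, fun A => ?_⟩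
  · rw [← eval_finsetSum, Lagrange.sum_basis (Function.injective_id.injOn)
      (Finset.card_pos.1 (by omega)), eval_one]
  · let b := Module.finBasis ℝ E
    let M := LinearMap.toMatrix b b (A : E →ₗ[ℝ] E)
    let p : ℝ[X] := Matrix.det ((X : ℝ[X]) • M.map C + (1 : Matrix _ _ ℝ).map C)
    have hp : ∀ t : ℝ, p.eval t = (1 + t • A).det := by
      intro t
      have : p.eval t = Matrix.det (t • M + 1) := by
        simp only [p]
        rw [← coe_evalRingHom, RingHom.map_det]
        congr 1
        ext i j
        by_cases hij : i = j
        · subst hij; simp [mul_comm (M _ _)]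
        · simp [Matrix.one_apply_ne hij, mul_comm (M _ _)]
      rw [this, ContinuousLinearMap.det, ← LinearMap.det_toMatrix b]
      congr 1
      simp [M, LinearMap.toMatrix_one, add_comm]
    have hdeg : p.degree < s.card := by
      refine lt_of_le_of_lt degree_le_natDegree ?_
      have := natDegree_det_X_add_C_le M 1
      simp only [Fintype.card_fin] at this
      rw [hs]
      exact_mod_cast Nat.lt_succ_of_le this
    have h := Lagrange.eq_interpolate (v := id) Function.injective_id.injOn hdeg
    have h1 := congrArg (eval 1) h
    rw [hp, Lagrange.interpolate_apply, eval_finsetSum] at h1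
    simp only [one_smul, id, eval_mul, eval_C, hp] at h1
    rw [h1]
    exact Finset.sum_congr rfl fun t _ => mul_comm _ _

theorem LipschitzOnWith.of_eqOn_sphere {E F : Type*} [NormedAddCommGroup E] [NormedSpace ℝ E]
    [NormedAddCommGroup F] {k : E → F} {R : ℝ} {L : NNReal}
    (hk : LipschitzOnWith L k (closedBall 0 R)) (h0 : ∀ x, R ≤ ‖x‖ → k x = 0) :
    LipschitzWith L k := by
  have key : ∀ x y : E, ‖x‖ ≤ R → R ≤ ‖y‖ → dist (k x) (k y) ≤ L * dist x y := by
    intro x y hx hy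
    have hc : ContinuousOn (fun t : ℝ => ‖AffineMap.lineMap x y t‖) (Icc 0 1) := by fun_prop
    obtain ⟨t, ht, hz⟩ := intermediate_value_Icc zero_le_one hc
      (show R ∈ Icc _ _ by simpa using ⟨hx, hy⟩)
    have := hk.dist_le_mul x (by simpa using hx) (AffineMap.lineMap x y t)
      (by simpa using hz.le)
    rw [h0 y hy, ← h0 _ hz.ge]
    refine this.trans ?_
    rw [dist_left_lineMap, Real.norm_of_nonneg ht.1]
    gcongr
    exact mul_le_of_le_one_left dist_nonneg ht.2
  refine LipschitzWith.of_dist_le_mul fun x y => ?_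
  rcases le_total ‖x‖ R with hx | hx <;> rcases le_total ‖y‖ R with hy | hy
  · exact hk.dist_le_mul x (by simpa using hx) y (by simpa using hy)
  · exact key x y hx hy
  · rw [dist_comm, dist_comm x]; exact key y x hy hx
  · rw [h0 x hx, h0 y hy, dist_self]; positivity

/-- A smooth map of a ball onto its boundary sphere cannot fix the sphere. -/
theorem not_exists_contDiff_retraction {E : Type*} [NormedAddCommGroup E] [InnerProductSpace ℝ E]
    [FiniteDimensional ℝ E] (r : E → E) (hr : ContDiff ℝ 1 r) {R : ℝ} (hR : 0 < R)
    (hn : ∀ x, ‖r x‖ = R) (hb : ∀ x, ‖x‖ = R → r x = x) : False := by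
  borelize E
  let k : E → E := fun x => if ‖x‖ ≤ R then r x - x else 0
  have hk0 : ∀ x, R ≤ ‖x‖ → k x = 0 := by
    intro x hx
    simp only [k]
    split_ifs with h
    · rw [hb x (le_antisymm h hx), sub_self]
    · rfl
  have hd : ContDiff ℝ 1 (fun x => r x - x) := hr.sub contDiff_id
  obtain ⟨L, hL⟩ : ∃ L, LipschitzOnWith L k (closedBall 0 R) := by
    obtain ⟨L, hL⟩ := hd.contDiffOn.exists_lipschitzOnWith (s := closedBall (0 : E) R) one_ne_zero
      (convex_closedBall 0 R) (isCompact_closedBall 0 R)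
    refine ⟨L, fun x hx y hy => ?_⟩
    simpa [k, mem_closedBall_zero_iff.1 hx, mem_closedBall_zero_iff.1 hy] using hL hx hy
  have hLk := hL.of_eqOn_sphere hk0
  let A : E → E →L[ℝ] E := fun x => fderiv ℝ (fun x => r x - x) x
  have hA : Continuous A := hd.continuous_fderiv one_ne_zero
  have hkA : ∀ x ∈ ball (0 : E) R, HasFDerivAt k (A x) x := by
    intro x hx
    refine ((hd.differentiable one_ne_zero x).hasFDerivAt).congr_of_eventuallyEq ?_
    filter_upwards [isOpen_ball.mem_nhds hx] with y hy
    simp [k, (mem_ball_zero_iff.1 hy).le]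
  have hvol : ∀ t : ℝ, 0 < t → t * (L + 1) < 1 / 2 →
      (∀ x ∈ ball (0 : E) R, 0 ≤ (1 + t • A x).det) →
      ∫ x in ball (0 : E) R, (1 + t • A x).det = volume.real (ball (0 : E) R) := by
    intro t ht htL hpos
    let f : E → E := fun x => x + t • k x
    have hap : ApproximatesLinearOn f ((ContinuousLinearEquiv.refl ℝ E : E ≃L[ℝ] E) : E →L[ℝ] E)
        univ (t.toNNReal * L) := by
      intro x _ y _
      have := hLk.dist_le_mul x y
      rw [dist_eq_norm, dist_eq_norm] at this
      have e : f x - f y - (x - y) = t • (k x - k y) := by simp only [f, smul_sub]; abel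
      simp only [ContinuousLinearEquiv.coe_refl, ContinuousLinearMap.id_apply, e, norm_smul,
        Real.norm_of_nonneg ht.le, NNReal.coe_mul, Real.coe_toNNReal t ht.le]
      rw [mul_assoc]
      gcongr
    have hc : Subsingleton E ∨
        t.toNNReal * L < ‖((ContinuousLinearEquiv.refl ℝ E).symm : E →L[ℝ] E)‖₊⁻¹ := by
      rcases subsingleton_or_nontrivial E with h | h
      · exact Or.inl h
      · right
        have : ‖((ContinuousLinearEquiv.refl ℝ E).symm : E →L[ℝ] E)‖₊ = 1 := by
          ext; simp
        rw [this, inv_one, ← NNReal.coe_lt_coe, NNReal.coe_mul, Real.coe_toNNReal t ht.le]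
        push_cast
        nlinarith [L.coe_nonneg]
    have hinj : Function.Injective f := injOn_univ.1 (hap.injOn hc)
    have hsurj := hap.surjective hc
    have hout : ∀ x, R ≤ ‖x‖ → f x = x := fun x hx => by simp [f, hk0 x hx]
    have ht1 : t < 1 := by nlinarith [L.coe_nonneg]
    have hin : ∀ x, ‖x‖ < R → ‖f x‖ < R := by
      intro x hx
      have e : f x = (1 - t) • x + t • r x := by
        simp only [f, k, if_pos hx.le, smul_sub, sub_smul, one_smul]; abel
      rw [e]
      calc _ ≤ ‖(1 - t) • x‖ + ‖t • r x‖ := norm_add_le _ _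
        _ = (1 - t) * ‖x‖ + t * R := by
          rw [norm_smul, norm_smul, hn, Real.norm_of_nonneg ht.le,
            Real.norm_of_nonneg (by linarith)]
        _ < R := by nlinarith
    have himg : f '' ball 0 R = ball (0 : E) R := by
      ext y
      simp only [mem_image, mem_ball_zero_iff]
      constructor
      · rintro ⟨x, hx, rfl⟩; exact hin x hx
      · intro hy
        obtain ⟨x, rfl⟩ := hsurj y
        refine ⟨x, ?_, rfl⟩
        by_contra! h
        rw [hout x h] at hy
        linarith
    have hcv := integral_image_eq_integral_abs_det_fderiv_smul volume
      (s := ball (0 : E) R) (f := f) (f' := fun x => 1 + t • A x) measurableSet_ball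
      (fun x hx => ((hasFDerivAt_id x).add ((hkA x hx).const_smul t)).hasFDerivWithinAt)
      hinj.injOn (fun _ => (1 : ℝ))
    rw [himg] at hcv
    simp only [integral_const, smul_eq_mul, mul_one, measureReal_restrict_apply_univ] at hcv
    rw [hcv]
    exact setIntegral_congr_fun measurableSet_ball fun x hx => (abs_of_nonneg (hpos x hx)).symm
  have hdetc : Continuous fun p : ℝ × E => (1 + p.1 • A p.2).det := by
    exact ContinuousLinearMap.continuous_det.comp (by fun_prop)
  obtain ⟨δ, hδ, hpos⟩ : ∃ δ > 0, ∀ t : ℝ, 0 ≤ t → t < δ → ∀ x ∈ ball (0 : E) R,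
      0 ≤ (1 + t • A x).det := by
    have hU : IsOpen {p : ℝ × E | 0 < (1 + p.1 • A p.2).det} := isOpen_lt continuous_const hdetc
    obtain ⟨u, v, hu, -, h0u, hv, huv⟩ := generalized_tube_lemma (s := {(0 : ℝ)})
      (t := closedBall (0 : E) R) isCompact_singleton
      (isCompact_closedBall 0 R) hU (by
        rintro ⟨a, b⟩ ⟨rfl, -⟩
        simp [ContinuousLinearMap.det])
    obtain ⟨δ, hδ, hb⟩ := Metric.isOpen_iff.1 hu 0 (h0u rfl)
    refine ⟨δ, hδ, fun t h0 h1 x hx => ?_⟩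
    exact (huv (show (t, x) ∈ u ×ˢ v from
      ⟨hb (by simpa [abs_of_nonneg h0] using h1), hv (ball_subset_closedBall hx)⟩)).le
  set η := min δ (1 / (2 * (L + 1)))
  have hη : 0 < η := lt_min hδ (by positivity)
  obtain ⟨s, hsub, hcard⟩ := (Ioo_infinite hη).exists_subset_card_eq (Module.finrank ℝ E + 1)
  obtain ⟨w, hw1, hw⟩ := exists_weights_det_one_add s hcard
  have hint : ∀ t : ℝ, IntegrableOn (fun x => (1 + t • A x).det) (ball (0 : E) R) := by
    intro t
    have : Continuous fun x => (1 + t • A x).det := hdetc.comp (Continuous.prodMk_right t)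
    exact (this.continuousOn.integrableOn_compact (isCompact_closedBall 0 R)).mono_set
      ball_subset_closedBall
  have hzero : ∀ x ∈ ball (0 : E) R, (1 + A x).det = 0 := by
    intro x hx
    have e : 1 + A x = fderiv ℝ r x := by
      have : A x = fderiv ℝ r x - ContinuousLinearMap.id ℝ E := by
        exact ((hr.differentiable one_ne_zero x).hasFDerivAt.sub (hasFDerivAt_id x)).fderiv
      rw [this]; ext; simp
    have hdr := (hr.differentiable one_ne_zero x).hasFDerivAt
    have hns : HasFDerivAt (fun y => ‖r y‖ ^ 2) (0 : E →L[ℝ] ℝ) x := by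
      simp only [hn]; exact hasFDerivAt_const _ _
    have h2 := hdr.norm_sq.unique hns
    rw [e]
    by_contra hne
    have hbij : Function.Surjective (fderiv ℝ r x) := by
      have : IsUnit (LinearMap.det (fderiv ℝ r x : E →ₗ[ℝ] E)) := isUnit_iff_ne_zero.2 hne
      intro y
      obtain ⟨z, hz⟩ := (LinearMap.equivOfIsUnitDet this).surjective y
      exact ⟨z, by simpa using hz⟩
    obtain ⟨z, hz⟩ := hbij (r x)
    have h3 := DFunLike.congr_fun h2 z
    simp [hz, hn] at h3
    exact hR.ne' h3
  have hI : ∫ x in ball (0 : E) R, (1 + A x).det = 0 :=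
    setIntegral_eq_zero_of_forall_eq_zero hzero
  rw [show (fun x => (1 + A x).det) = fun x => ∑ t ∈ s, w t * (1 + t • A x).det from
    funext fun x => hw (A x), integral_finsetSum _ fun t _ => (hint t).const_mul _] at hI
  simp only [integral_const_mul] at hI
  rw [Finset.sum_congr rfl fun t ht => by
    have h := hsub ht
    rw [hvol t h.1 ?_ (hpos t h.1.le (h.2.trans_le (min_le_left _ _)))]
    have h2 := h.2.trans_le (min_le_right _ _)
    rw [lt_div_iff₀ (by positivity)] at h2
    linarith, ← Finset.sum_mul, hw1, one_mul] at hI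
  have : 0 < volume.real (ball (0 : E) R) := by
    rw [measureReal_def]
    exact ENNReal.toReal_pos (measure_ball_pos _ _ hR).ne' measure_ball_lt_top.ne
  linarith

theorem exists_eq_zero_of_eq_self_outside_ball_aux {E : Type*} [NormedAddCommGroup E]
    [InnerProductSpace ℝ E] [FiniteDimensional ℝ E] {f : E → E} (hf : Continuous f) {R : ℝ}
    (h : ∀ x, R ≤ ‖x‖ → f x = x) : ∃ x, f x = 0 := by
  by_contra! hne
  wlog hR : 0 < R generalizing R
  · exact this (R := 1) (fun x hx => h x (by linarith)) one_pos
  obtain ⟨m, hm, hfm⟩ : ∃ m > 0, ∀ x, m ≤ ‖f x‖ := by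
    obtain ⟨x₀, -, hx₀⟩ := (isCompact_closedBall (0 : E) R).exists_isMinOn
      ⟨0, by simpa using hR.le⟩ hf.norm.continuousOn
    refine ⟨min R ‖f x₀‖, lt_min hR (norm_pos_iff.2 (hne _)), fun x => ?_⟩
    rcases le_total ‖x‖ R with hx | hx
    · exact (min_le_right _ _).trans (hx₀ (by simpa using hx))
    · rw [h x hx]; exact (min_le_left _ _).trans hx
  obtain ⟨g, hg, hgf, hgS, -⟩ := hf.exists_contDiff_approx_and_eqOn (1 : ℕ∞)
    (ε := fun _ => m / 2) continuous_const (fun _ => half_pos hm)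
    (S := {x | R + 1 ≤ ‖x‖}) (U := {x | R < ‖x‖})
    (isClosed_le continuous_const continuous_norm)
    ((isOpen_lt continuous_const continuous_norm).mem_nhdsSet.2 fun x hx => by
      have : R + 1 ≤ ‖x‖ := hx
      show R < ‖x‖
      linarith)
    (contDiffOn_id.congr fun x hx => h x (le_of_lt hx))
  have hg0 : ∀ x, g x ≠ 0 := by
    intro x hx
    have h1 := hgf x
    rw [hx, dist_zero_left] at h1
    linarith [hfm x]
  have hR1 : 0 < R + 1 := by linarith
  refine not_exists_contDiff_retraction (fun x => ((R + 1) * ‖g x‖⁻¹) • g x)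
    (by
      have hg' : ContDiff ℝ 1 g := hg
      exact (contDiff_const.mul ((hg'.norm ℝ hg0).inv fun x => norm_ne_zero_iff.2 (hg0 x))).smul
        hg')
    hR1 (fun x => ?_) (fun x hx => ?_)
  · have := norm_ne_zero_iff.2 (hg0 x)
    rw [norm_smul, norm_mul, norm_inv, norm_norm, Real.norm_of_nonneg hR1.le]
    field_simp
  · have : g x = x := (hgS hx.ge).trans (h x (by linarith))
    simp only [this, hx, mul_inv_cancel₀ hR1.ne', one_smul]

/-- A continuous self-map of a finite-dimensional space which is the identity near infinity
has a zero. -/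
theorem exists_eq_zero_of_eq_self_outside_ball {E : Type*} [NormedAddCommGroup E]
    [NormedSpace ℝ E] [FiniteDimensional ℝ E] {f : E → E} (hf : Continuous f) {R : ℝ}
    (h : ∀ x, R ≤ ‖x‖ → f x = x) : ∃ x, f x = 0 := by
  let e : E ≃L[ℝ] EuclideanSpace ℝ (Fin (Module.finrank ℝ E)) :=
    ContinuousLinearEquiv.ofFinrankEq (by simp)
  obtain ⟨K, hK, hKe⟩ :=
    (e : E →L[ℝ] EuclideanSpace ℝ (Fin (Module.finrank ℝ E))).isBoundedLinearMap.bound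
  obtain ⟨x, hx⟩ := exists_eq_zero_of_eq_self_outside_ball_aux
    (f := fun x => e (f (e.symm x))) (by fun_prop) (R := K * R) (fun x hx => by
      rw [h, e.apply_symm_apply]
      have := hKe (e.symm x)
      simp only [ContinuousLinearEquiv.coe_coe, e.apply_symm_apply] at this
      exact le_of_mul_le_mul_left (hx.trans this) hK)
  exact ⟨e.symm x, by simpa using hx⟩

/-- Poincaré–Bohl: a continuous self-map of a finite-dimensional space which outside a ball never
points towards a given point `p` has a zero. -/
theorem exists_eq_zero_of_ne_neg_smul {E : Type*} [NormedAddCommGroup E]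
    [NormedSpace ℝ E] [FiniteDimensional ℝ E] {G : E → E} (hG : Continuous G) (p : E) {R : ℝ}
    (h : ∀ x, R ≤ ‖x - p‖ → ∀ c : ℝ, 0 ≤ c → G x ≠ -(c • (x - p))) : ∃ x, G x = 0 := by
  wlog hR : 0 < R generalizing R
  · exact this (R := 1) (fun x hx => h x (by linarith)) one_pos
  let χ : E → ℝ := fun x => min 1 (max 0 (‖x‖ - R))
  have hχ0 : ∀ x, 0 ≤ χ x := fun x => le_min zero_le_one (le_max_left _ _)
  have hχ1 : ∀ x, χ x ≤ 1 := fun x => min_le_left _ _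
  obtain ⟨x, hx⟩ := exists_eq_zero_of_eq_self_outside_ball (R := R + 1)
    (f := fun x => (1 - χ x) • G (x + p) + χ x • x) (by fun_prop) (fun x hx => by
      have : χ x = 1 := min_eq_left (le_max_of_le_right (by linarith))
      simp [this])
  refine ⟨x + p, ?_⟩
  rcases le_or_gt ‖x‖ R with hxR | hxR
  · have : χ x = 0 := by
      simp only [χ]
      rw [max_eq_left (by linarith), min_eq_right zero_le_one]
    simpa [this] using hx
  · exfalso
    rcases (hχ1 x).eq_or_lt with h1 | h1
    · have : x = 0 := by simpa [h1] using hx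
      rw [this, norm_zero] at hxR
      linarith
    · have h2 : 0 < 1 - χ x := by linarith
      refine h (x + p) (by simpa using hxR.le) (χ x / (1 - χ x)) (div_nonneg (hχ0 x) h2.le) ?_
      have h3 := congrArg (fun v => (1 - χ x)⁻¹ • v) (eq_neg_of_add_eq_zero_left hx)
      simp only [smul_smul, inv_mul_cancel₀ h2.ne', one_smul, smul_neg] at h3
      rw [h3, add_sub_cancel_right, div_eq_inv_mul]

theorem exists_approx_ne_zero_of_addHaar_range_eq_zero {C E : Type*} [TopologicalSpace C]
    [CompactSpace C] [NormedAddCommGroup E] [NormedSpace ℝ E] [FiniteDimensional ℝ E]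
    [MeasurableSpace E] [BorelSpace E] (μ : Measure E) [μ.IsAddHaarMeasure]
    {ι : C → E} (hι : Continuous ι) (hinj : Function.Injective ι) (h0 : μ (range ι) = 0)
    (f : C(C, E)) {ε : ℝ} (hε : 0 < ε) :
    ∃ g : C(C, E), (∀ x, dist (g x) (f x) < ε) ∧ ∀ x, g x ≠ 0 := by
  have : TietzeExtension E := TietzeExtension.of_tvs ℝ
  obtain ⟨F, hF⟩ := f.exists_extension' (hι.isClosedEmbedding hinj)
  obtain ⟨g, hg, hgF, -⟩ := F.continuous.exists_contDiff_approx (1 : ℕ∞)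
    (ε := fun _ => ε / 2) continuous_const (fun _ => half_pos hε)
  have hg' : ContDiff ℝ 1 g := hg
  have hnull : μ (g '' range ι) = 0 :=
    addHaar_image_eq_zero_of_differentiableOn_of_addHaar_eq_zero μ
      (hg'.differentiable one_ne_zero).differentiableOn h0
  obtain ⟨q, hq, hqg⟩ : ∃ q ∈ ball (0 : E) (ε / 2), q ∉ g '' range ι := by
    by_contra! h
    exact (measure_ball_pos μ (0 : E) (half_pos hε)).ne' (measure_mono_null h hnull)
  refine ⟨⟨fun x => g (ι x) - q, by have := hg'.continuous; fun_prop⟩, fun x => ?_, fun x hx => ?_⟩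
  · have h1 := hgF (ι x)
    rw [show F (ι x) = f x from congrFun hF x, dist_eq_norm] at h1
    rw [mem_ball_zero_iff] at hq
    rw [dist_eq_norm]
    calc ‖g (ι x) - q - f x‖ = ‖(g (ι x) - f x) - q‖ := by congr 1; abel
      _ ≤ ‖g (ι x) - f x‖ + ‖q‖ := norm_sub_le _ _
      _ < ε := by linarith
  · exact hqg ⟨ι x, mem_range_self x, sub_eq_zero.1 hx⟩

/-- Weak invariance of domain: a ball cannot be embedded into a space of smaller dimension. -/
theorem finrank_le_of_continuousOn_injOn_closedBall {E F : Type*} [NormedAddCommGroup E]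
    [NormedSpace ℝ E] [FiniteDimensional ℝ E] [NormedAddCommGroup F]
    [NormedSpace ℝ F] [FiniteDimensional ℝ F] {ρ : ℝ} (hρ : 0 < ρ) {φ : E → F}
    (hφ : ContinuousOn φ (closedBall 0 ρ)) (hinj : InjOn φ (closedBall 0 ρ)) :
    Module.finrank ℝ E ≤ Module.finrank ℝ F := by
  by_contra! hlt
  borelize E
  obtain ⟨j, hj⟩ : ∃ j : F →ₗ[ℝ] E, Function.Injective j :=
    finrank_le_iff_exists_linearMap.1 hlt.le
  have hjt : LinearMap.range j ≠ ⊤ := by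
    intro h
    have := LinearMap.finrank_range_of_inj hj
    rw [h, finrank_top] at this
    omega
  have : CompactSpace (closedBall (0 : E) ρ) :=
    isCompact_iff_compactSpace.1 (isCompact_closedBall 0 ρ)
  have : TietzeExtension E := TietzeExtension.of_tvs ℝ
  obtain ⟨g, hg, hg0⟩ := exists_approx_ne_zero_of_addHaar_range_eq_zero
    (Measure.addHaar : Measure E) (C := closedBall (0 : E) ρ)
    (ι := fun x => j (φ x)) (j.continuous_of_finiteDimensional.comp hφ.domRestrict)
    (hj.comp (injOn_iff_injective.1 hinj))
    (measure_mono_null (by rintro _ ⟨x, rfl⟩; exact LinearMap.mem_range_self j _)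
      (Measure.addHaar_submodule _ (LinearMap.range j) hjt))
    ⟨Subtype.val, continuous_subtype_val⟩ (half_pos hρ)
  obtain ⟨G, hG⟩ := g.exists_restrict_eq isClosed_closedBall
  have hGg : ∀ x (hx : x ∈ closedBall (0 : E) ρ), G x = g ⟨x, hx⟩ := fun x hx =>
    DFunLike.congr_fun hG ⟨x, hx⟩
  let χ : E → ℝ := fun x => max 0 (min 1 (2 - 2 * (‖x‖ / ρ)))
  have hχ0 : ∀ x, 0 ≤ χ x := fun x => le_max_left _ _
  have hχ1 : ∀ x, χ x ≤ 1 := fun x => max_le zero_le_one (min_le_left _ _)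
  have hout : ∀ x, ρ ≤ ‖x‖ → χ x = 0 := fun x hx =>
    max_eq_left ((min_le_right _ _).trans (by
      have := (one_le_div hρ).2 hx; linarith))
  have hin : ∀ x, ‖x‖ ≤ ρ / 2 → χ x = 1 := fun x hx => by
    have : ‖x‖ / ρ ≤ 1 / 2 := by rw [div_le_iff₀ hρ]; linarith
    simp only [χ]
    rw [min_eq_left (by linarith), max_eq_right zero_le_one]
  obtain ⟨x, hx⟩ := exists_eq_zero_of_eq_self_outside_ball (R := ρ)
    (f := fun x => x + χ x • (G x - x)) (by fun_prop) (fun x hx => by simp [hout x hx])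
  have hxρ : ‖x‖ < ρ := by
    by_contra! h
    have : x = 0 := by simpa [hout x h] using hx
    rw [this, norm_zero] at h
    linarith
  have hxm : x ∈ closedBall (0 : E) ρ := by simpa using hxρ.le
  have h1 := hg ⟨x, hxm⟩
  rw [← hGg, dist_eq_norm] at h1
  have h2 : ‖x‖ ≤ ρ / 2 := by
    rw [eq_neg_of_add_eq_zero_left hx, norm_neg, norm_smul, Real.norm_of_nonneg (hχ0 x)]
    exact (mul_le_of_le_one_left (norm_nonneg _) (hχ1 x)).trans h1.le
  rw [hin x h2, one_smul, add_sub_cancel, hGg x hxm] at hx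
  exact hg0 _ hx

theorem exists_extension_norm_le {X Y E : Type*} [TopologicalSpace X] [TopologicalSpace Y]
    [NormalSpace Y] [NormedAddCommGroup E] [NormedSpace ℝ E] [FiniteDimensional ℝ E] {e : X → Y}
    (he : IsClosedEmbedding e) (f : C(X, E)) {ε : ℝ} (hε : 0 < ε) (hf : ∀ x, ‖f x‖ ≤ ε) :
    ∃ g : C(Y, E), (∀ y, ‖g y‖ ≤ ε) ∧ ∀ x, g (e x) = f x := by
  have : TietzeExtension E := TietzeExtension.of_tvs ℝ
  obtain ⟨g, hg⟩ := f.exists_extension' he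
  have hpos : ∀ y, 0 < max ε ‖g y‖ := fun y => lt_max_of_lt_left hε
  refine ⟨⟨fun y => (ε / max ε ‖g y‖) • g y, ?_⟩, fun y => ?_, fun x => ?_⟩
  · exact (continuous_const.div (by fun_prop) fun y => (hpos y).ne').smul g.continuous
  · have := hpos y
    simp only [ContinuousMap.coe_mk, norm_smul, norm_div, Real.norm_of_nonneg hε.le,
      Real.norm_of_nonneg this.le]
    rw [div_mul_eq_mul_div, div_le_iff₀ this]
    gcongr
    exact le_max_right _ _
  · have : g (e x) = f x := congrFun hg x
    simp only [ContinuousMap.coe_mk, this]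
    rw [max_eq_left (hf x), div_self hε.ne', one_smul]

theorem UnitAddCircle.exists_zsmul_eq_of_fourier_eq_one {k : ℕ} (hk : k ≠ 0) {s : UnitAddCircle}
    (h : fourier (k : ℤ) s = 1) : ∃ m : ℤ, s = m • (((k : ℝ)⁻¹ : ℝ) : UnitAddCircle) := by
  induction s using QuotientAddGroup.induction_on with
  | H r =>
    rw [fourier_apply] at h
    have h1 : AddCircle.toCircle ((k : ℤ) • ((r : ℝ) : UnitAddCircle)) =
        AddCircle.toCircle (0 : UnitAddCircle) := by
      ext; rw [AddCircle.toCircle_zero]; exact h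
    have h2 := AddCircle.injective_toCircle one_ne_zero h1
    have h3 : (((k : ℤ) • r : ℝ) : UnitAddCircle) = 0 := h2
    rw [AddCircle.coe_eq_zero_iff] at h3
    obtain ⟨m, hm⟩ := h3
    refine ⟨m, ?_⟩
    have hk' : (k : ℝ) ≠ 0 := by exact_mod_cast hk
    have : r = m • (k : ℝ)⁻¹ := by
      simp only [zsmul_eq_mul, mul_one, Int.cast_natCast] at hm ⊢
      field_simp
      linarith
    rw [this]
    rfl

section FourierCoeff

variable {C : Type*} [AddAction UnitAddCircle C]

theorem fourierCoeff_vadd (φ : C → ℂ) (k : ℤ) (t : UnitAddCircle) (y : C) :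
    fourierCoeff (fun s : UnitAddCircle => φ (s +ᵥ (t +ᵥ y))) k =
      fourier k t * fourierCoeff (fun s : UnitAddCircle => φ (s +ᵥ y)) k := by
  unfold fourierCoeff
  rw [← integral_const_mul, ← integral_add_right_eq_self
    (fun s : UnitAddCircle => fourier k t * fourier (-k) s • φ (s +ᵥ y)) t]
  congr 1
  ext s
  have h1 : fourier (-k) (s + t) = fourier (-k) s * fourier (-k) t := by
    simp [fourier_apply, smul_add, AddCircle.toCircle_add]
  have h2 : fourier k t * fourier (-k) t = 1 := by
    rw [← fourier_add, add_neg_cancel, fourier_zero]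
  simp only [vadd_vadd, h1, smul_eq_mul]
  linear_combination (-(fourier (-k) s * φ ((s + t) +ᵥ y))) * h2

variable [TopologicalSpace C] [CompactSpace C] [R1Space C] [FirstCountableTopology C]
  [ContinuousVAdd UnitAddCircle C]

theorem continuous_fourierCoeff_vadd (φ : C(C, ℂ)) (k : ℤ) :
    Continuous fun y => fourierCoeff (fun s : UnitAddCircle => φ (s +ᵥ y)) k := by
  have := continuous_parametric_integral_of_continuous (μ := AddCircle.haarAddCircle)
    (f := fun (y : C) (s : UnitAddCircle) => fourier (-k) s • φ (s +ᵥ y))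
    (by
      unfold Function.uncurry
      fun_prop) isCompact_univ
  simpa only [setIntegral_univ] using! this

end FourierCoeff

section Slices

variable {C : Type*} [AddAction UnitAddCircle C] [TopologicalSpace C]

/-- The points of a circle action fixed by the `k`-torsion of the circle at which the `k`-th
Fourier coefficient of `φ` along the orbit is real and at least `1 / (j + 1)`. -/
def fourierSlice (φ : C(C, ℂ)) (k j : ℕ) : Set C :=
  {y | (((k : ℝ)⁻¹ : ℝ) : UnitAddCircle) +ᵥ y = y ∧
    (fourierCoeff (fun s : UnitAddCircle => φ (s +ᵥ y)) k).im = 0 ∧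
    1 / ((j : ℝ) + 1) ≤ (fourierCoeff (fun s : UnitAddCircle => φ (s +ᵥ y)) k).re}

theorem isClosed_fourierSlice [T2Space C] [CompactSpace C] [FirstCountableTopology C]
    [ContinuousVAdd UnitAddCircle C] (φ : C(C, ℂ)) (k j : ℕ) : IsClosed (fourierSlice φ k j) := by
  have := continuous_fourierCoeff_vadd φ k
  exact (isClosed_eq (by fun_prop) continuous_id).inter
    ((isClosed_eq (Complex.continuous_im.comp this) continuous_const).inter
      (isClosed_le continuous_const (Complex.continuous_re.comp this)))

theorem exists_zsmul_eq_of_mem_fourierSlice {φ : C(C, ℂ)} {k j : ℕ} (hk : k ≠ 0) {y : C}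
    {t : UnitAddCircle} (hy : y ∈ fourierSlice φ k j) (hty : t +ᵥ y ∈ fourierSlice φ k j) :
    ∃ m : ℤ, t = m • (((k : ℝ)⁻¹ : ℝ) : UnitAddCircle) := by
  refine UnitAddCircle.exists_zsmul_eq_of_fourier_eq_one hk ?_
  obtain ⟨-, hi, hr⟩ := hy
  obtain ⟨-, hi', hr'⟩ := hty
  rw [fourierCoeff_vadd] at hi' hr'
  set z := fourierCoeff (fun s : UnitAddCircle => φ (s +ᵥ y)) k
  have hj : 0 < 1 / ((j : ℝ) + 1) := by positivity
  have hn : ‖(fourier (k : ℤ) t : ℂ)‖ = 1 := by rw [fourier_apply]; exact Circle.norm_coe _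
  have hz : z = (z.re : ℂ) := Complex.ext rfl (by simpa using hi)
  have hre : 0 < z.re := hj.trans_le hr
  rw [hz, Complex.im_mul_ofReal] at hi'
  rw [hz, Complex.re_mul_ofReal] at hr'
  have h1 : (fourier (k : ℤ) t : ℂ).im = 0 := (mul_eq_zero.1 hi').resolve_right hre.ne'
  have h2 : 0 < (fourier (k : ℤ) t : ℂ).re := by
    by_contra! h
    nlinarith
  have h3 : (fourier (k : ℤ) t : ℂ) = ((fourier (k : ℤ) t : ℂ).re : ℂ) :=
    Complex.ext rfl (by simpa using h1)
  rw [h3, Complex.norm_real, Real.norm_of_nonneg h2.le] at hn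
  rw [h3, hn, Complex.ofReal_one]

theorem vadd_eq_of_mem_fourierSlice {φ : C(C, ℂ)} {k j : ℕ} (hk : k ≠ 0) {y : C}
    {t : UnitAddCircle} (hy : y ∈ fourierSlice φ k j) (hty : t +ᵥ y ∈ fourierSlice φ k j) :
    t +ᵥ y = y := by
  obtain ⟨m, rfl⟩ := exists_zsmul_eq_of_mem_fourierSlice hk hy hty
  exact AddSubgroup.zsmul_mem (AddAction.stabilizer UnitAddCircle y) hy.1 m

theorem exists_measure_range_vadd_fourierSlice_eq_zero [T2Space C] [CompactSpace C]
    [FirstCountableTopology C] [ContinuousVAdd UnitAddCircle C] {E : Type*} [TopologicalSpace E]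
    [T2Space E] [MeasurableSpace E] [OpensMeasurableSpace E] (μ : Measure E) [SFinite μ] {ι : C → E}
    (hι : Continuous ι) (hinj : Function.Injective ι) (φ : C(C, ℂ)) {k : ℕ} (hk : k ≠ 0) (j : ℕ) :
    ∃ t : UnitAddCircle, μ (range fun a : fourierSlice φ k j => ι (t +ᵥ (a : C))) = 0 := by
  have hcpt : CompactSpace (fourierSlice φ k j) :=
    isCompact_iff_compactSpace.1 (isClosed_fourierSlice φ k j).isCompact
  have hk0 : (0 : ℝ) < (k : ℝ)⁻¹ := inv_pos.2 (by exact_mod_cast Nat.pos_of_ne_zero hk)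
  let S : Ioo (0 : ℝ) (k : ℝ)⁻¹ → Set E := fun t =>
    range fun a : fourierSlice φ k j => ι (((t : ℝ) : UnitAddCircle) +ᵥ (a : C))
  by_contra! h
  have hmeas : ∀ t, MeasurableSet (S t) := fun t =>
    (isCompact_range (by fun_prop)).isClosed.measurableSet
  have hdisj : Pairwise (Function.onFun Disjoint S) := by
    intro t t' htt'
    refine disjoint_left.2 ?_
    rintro _ ⟨a, rfl⟩ ⟨b, hb⟩
    have hb' := hinj hb
    apply htt'
    have hmem : (((t' : ℝ) - t : ℝ) : UnitAddCircle) +ᵥ (b : C) = a := by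
      rw [AddCircle.coe_sub, sub_eq_neg_add, ← vadd_vadd, hb', vadd_vadd, neg_add_cancel, zero_vadd]
    obtain ⟨m, hm⟩ := exists_zsmul_eq_of_mem_fourierSlice hk b.2 (hmem ▸ a.2)
    rw [← AddCircle.coe_zsmul, ← sub_eq_zero, ← AddCircle.coe_sub, AddCircle.coe_eq_zero_iff] at hm
    obtain ⟨l, hl⟩ := hm
    obtain ⟨t, ht⟩ := t
    obtain ⟨t', ht'⟩ := t'
    have hkR : (k : ℝ) ≠ 0 := by exact_mod_cast hk
    have hl' : (t' - t) = ((m + l * k : ℤ) : ℝ) * (k : ℝ)⁻¹ := by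
      simp only [zsmul_eq_mul, mul_one] at hl
      push_cast
      field_simp at hl ⊢
      linarith
    have h1 : |((m + l * k : ℤ) : ℝ)| < 1 := by
      have h2 : |t' - t| < (k : ℝ)⁻¹ :=
        abs_lt.2 ⟨by linarith [ht.2, ht'.1], by linarith [ht.1, ht'.2]⟩
      rw [hl', abs_mul, abs_of_pos hk0] at h2
      by_contra! h3
      nlinarith
    have h3 : (m + l * k : ℤ) = 0 := by
      rw [← Int.cast_abs] at h1
      exact Int.abs_lt_one_iff.1 (by exact_mod_cast h1)
    rw [h3] at hl'
    ext
    simp only [Int.cast_zero, zero_mul] at hl'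
    linarith
  have hc := Measure.countable_meas_pos_of_disjoint_iUnion (μ := μ) hmeas hdisj
  rw [show {i | 0 < μ (S i)} = univ from eq_univ_of_forall fun t => pos_iff_ne_zero.2 (h _)] at hc
  have h2 : (Ioo (0 : ℝ) (k : ℝ)⁻¹).Countable := by
    rw [← Set.countable_coe_iff]; exact countable_univ_iff.1 hc
  have h3 := h2.measure_zero volume
  rw [Real.volume_Ioo, sub_zero, ENNReal.ofReal_eq_zero] at h3
  linarith

theorem exists_vadd_mem_fourierSlice [T2Space C] [CompactSpace C]
    [FirstCountableTopology C] [ContinuousVAdd UnitAddCircle C] {y : C}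
    (hy : ∃ s : UnitAddCircle, s +ᵥ y ≠ y) {D : Set C(C, ℂ)} (hD : Dense D) :
    ∃ φ ∈ D, ∃ k j : ℕ, k ≠ 0 ∧ ∃ s : UnitAddCircle, s +ᵥ y ∈ fourierSlice φ k j := by
  let H : AddSubgroup ℝ :=
    (AddAction.stabilizer UnitAddCircle y).comap
      (QuotientAddGroup.mk' (AddSubgroup.zmultiples (1 : ℝ)))
  have hmemH : ∀ r : ℝ, r ∈ H ↔ (r : UnitAddCircle) +ᵥ y = y := fun r => Iff.rfl
  have hHcl : IsClosed (H : Set ℝ) := by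
    have : Continuous fun r : ℝ => (r : UnitAddCircle) +ᵥ y :=
      (AddCircle.continuous_mk' 1).vadd continuous_const
    exact isClosed_eq this continuous_const
  have h1H : (1 : ℝ) ∈ H := by
    rw [hmemH, AddCircle.coe_period, zero_vadd]
  obtain ⟨k, hk, hkH⟩ : ∃ k : ℕ, k ≠ 0 ∧ H = AddSubgroup.zmultiples ((k : ℝ)⁻¹) := by
    rcases AddSubgroup.dense_or_cyclic H with hd | ⟨a, ha⟩
    · exfalso
      obtain ⟨s, hs⟩ := hy
      induction s using QuotientAddGroup.induction_on with
      | H r =>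
        refine hs ((hmemH r).1 ?_)
        have : (H : Set ℝ) = univ := hHcl.closure_eq.symm.trans hd.closure_eq
        rw [← SetLike.mem_coe, this]
        exact mem_univ r
    · rw [← AddSubgroup.zmultiples_eq_closure] at ha
      rw [ha] at h1H
      obtain ⟨m, hm⟩ := AddSubgroup.mem_zmultiples_iff.1 h1H
      have hm0 : m ≠ 0 := by rintro rfl; simp at hm
      refine ⟨m.natAbs, Int.natAbs_ne_zero.2 hm0, ?_⟩
      have hmR : (m : ℝ) ≠ 0 := by exact_mod_cast hm0
      have ha' : a = (m : ℝ)⁻¹ := by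
        rw [zsmul_eq_mul] at hm
        field_simp
        linarith
      rw [ha, ha', Nat.cast_natAbs, Int.cast_abs]
      rcases abs_choice (m : ℝ) with h | h
      · rw [h]
      · rw [h, inv_neg, AddSubgroup.zmultiples_neg]
  have hkR : (k : ℝ) ≠ 0 := by exact_mod_cast hk
  let o : UnitAddCircle → C := fun s => s +ᵥ y
  have ho : Continuous o := by fun_prop
  obtain ⟨Φ, hΦ⟩ : ∃ Φ : C(C, ℂ), ∀ s : UnitAddCircle, Φ (s +ᵥ y) = fourier k s := by
    let q : C(UnitAddCircle, range o) := ⟨rangeFactorization o, ho.rangeFactorization⟩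
    have hq : IsQuotientMap q :=
      IsQuotientMap.of_surjective_continuous rangeFactorization_surjective q.continuous
    have hfac : Function.FactorsThrough (fourier (k : ℤ) : C(UnitAddCircle, ℂ)) q := by
      intro a b hab
      have hab' : a +ᵥ y = b +ᵥ y := congrArg Subtype.val hab
      have hsub : (a - b) +ᵥ y = y := by
        rw [sub_eq_neg_add, ← vadd_vadd, hab', vadd_vadd, neg_add_cancel, zero_vadd]
      have : fourier (k : ℤ) (a - b) = 1 := by
        generalize a - b = c at hsub
        induction c using QuotientAddGroup.induction_on with
        | H r =>
          have hr : r ∈ H := hsub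
          rw [hkH] at hr
          obtain ⟨m, rfl⟩ := AddSubgroup.mem_zmultiples_iff.1 hr
          have : (k : ℤ) • (m • (k : ℝ)⁻¹) = m • (1 : ℝ) := by
            simp only [zsmul_eq_mul]; push_cast; field_simp
          rw [fourier_apply]
          change ((AddCircle.toCircle (((k : ℤ) • (m • (k : ℝ)⁻¹) : ℝ) : UnitAddCircle) : Circle) : ℂ) =
            1
          rw [this, AddCircle.coe_zsmul, AddCircle.coe_period, smul_zero, AddCircle.toCircle_zero,
            Circle.coe_one]
      have h2 : (fourier (k : ℤ) a : ℂ) = fourier k (a - b) * fourier k b := by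
        rw [fourier_apply, fourier_apply, fourier_apply, ← Circle.coe_mul, ← AddCircle.toCircle_add,
          ← smul_add, sub_add_cancel]
      rw [h2, this, one_mul]
    obtain ⟨Φ, hΦ⟩ := (hq.lift (fourier (k : ℤ)) hfac).exists_restrict_eq
      (isCompact_range ho).isClosed
    refine ⟨Φ, fun s => ?_⟩
    have h1 := DFunLike.congr_fun hΦ (q s)
    have h2 := DFunLike.congr_fun (hq.lift_comp (fourier (k : ℤ)) hfac) s
    exact h1.trans h2
  obtain ⟨φ, hφΦ, hφD⟩ : ∃ φ ∈ ball Φ (1 / 2), φ ∈ D :=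
    hD.inter_open_nonempty _ isOpen_ball ⟨Φ, by simp⟩
  set z := fourierCoeff (fun s : UnitAddCircle => φ (s +ᵥ y)) k with hz
  have hz0 : z ≠ 0 := by
    intro h0
    have hΦ1 : fourierCoeff (fun s : UnitAddCircle => Φ (s +ᵥ y)) k = 1 := by
      unfold fourierCoeff
      simp only [hΦ, smul_eq_mul, ← fourier_add, neg_add_cancel, fourier_zero]
      simp
    have hint : ∀ ψ : C(C, ℂ), Integrable
        (fun s : UnitAddCircle => fourier (-(k : ℤ)) s • ψ (s +ᵥ y))
        AddCircle.haarAddCircle := fun ψ =>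
      (Continuous.integrable_of_hasCompactSupport (by fun_prop)
        (HasCompactSupport.of_compactSpace _))
    have : ‖fourierCoeff (fun s : UnitAddCircle => Φ (s +ᵥ y)) k - z‖ ≤ 1 / 2 := by
      rw [hz]
      unfold fourierCoeff
      rw [← integral_sub (hint _) (hint _)]
      refine (norm_integral_le_of_norm_le_const (C := 1 / 2)
        (Eventually.of_forall fun s => ?_)).trans
        (by simp)
      rw [← smul_sub, norm_smul, fourier_apply, Circle.norm_coe, one_mul, ← dist_eq_norm, dist_comm]
      exact (ContinuousMap.dist_apply_le_dist _).trans (mem_ball.1 hφΦ).le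
    rw [hΦ1, h0] at this
    norm_num at this
  obtain ⟨s, hs⟩ : ∃ s : UnitAddCircle, fourier (k : ℤ) s * z = (‖z‖ : ℂ) := by
    refine ⟨((-z.arg / (2 * Real.pi * k) : ℝ) : UnitAddCircle), ?_⟩
    rw [fourier_coe_apply]
    have hpi := Real.pi_ne_zero
    have : 2 * (Real.pi : ℂ) * Complex.I * ((k : ℕ) : ℤ) *
        ((-z.arg / (2 * Real.pi * k) : ℝ) : ℂ) / (1 : ℝ) = -(z.arg * Complex.I) := by
      have hkC : (k : ℂ) ≠ 0 := by exact_mod_cast hk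
      have hpC : (Real.pi : ℂ) ≠ 0 := by exact_mod_cast hpi
      push_cast
      field_simp
    rw [this]
    conv_lhs => rw [← Complex.norm_mul_exp_arg_mul_I z]
    rw [mul_left_comm, ← Complex.exp_add]
    simp
  obtain ⟨j, hj⟩ := exists_nat_one_div_lt (norm_pos_iff.2 hz0)
  refine ⟨φ, hφD, k, j, hk, s, ?_, ?_, ?_⟩
  · have : (k : ℝ)⁻¹ ∈ H := hkH ▸ AddSubgroup.mem_zmultiples _
    rw [vadd_vadd, add_comm, ← vadd_vadd, (hmemH _).1 this]
  · rw [fourierCoeff_vadd, hs, Complex.ofReal_im]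
  · rw [fourierCoeff_vadd, hs, Complex.ofReal_re]
    exact hj.le

end Slices

/-- For a circle action without fixed points on a compact subset of a finite-dimensional space,
every invariant map to that space can be perturbed off the origin. -/
theorem exists_approx_ne_zero_of_vadd_invariant {C E : Type*} [AddAction UnitAddCircle C]
    [TopologicalSpace C] [CompactSpace C] [ContinuousVAdd UnitAddCircle C]
    [NormedAddCommGroup E] [NormedSpace ℝ E] [FiniteDimensional ℝ E]
    (hfix : ∀ y : C, ∃ s : UnitAddCircle, s +ᵥ y ≠ y) {ι : C → E} (hι : Continuous ι)
    (hinj : Function.Injective ι) (f : C(C, E)) (hf : ∀ (s : UnitAddCircle) y, f (s +ᵥ y) = f y)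
    {ε : ℝ} (hε : 0 < ε) :
    ∃ g : C(C, E), (∀ x, dist (g x) (f x) < ε) ∧ ∀ x, g x ≠ 0 := by
  borelize E
  have hT2 : T2Space C := T2Space.of_injective_continuous hinj hι
  have hemb := hι.isClosedEmbedding hinj
  have hsc : SecondCountableTopology C := hemb.isEmbedding.secondCountableTopology
  have hproper : ProperVAdd UnitAddCircle C :=
    ⟨Continuous.isProperMap (by fun_prop)⟩
  let Q := Quotient (AddAction.orbitRel UnitAddCircle C)
  have hQ2 : T2Space Q := t2Space_quotient_addAction_of_properVAdd
  let π : C(C, Q) := ⟨Quotient.mk _, continuous_quot_mk⟩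
  have hπ : ∀ a b : C, π a = π b → ∃ s : UnitAddCircle, s +ᵥ b = a := fun a b hab =>
    Quotient.exact (s := AddAction.orbitRel UnitAddCircle C) hab
  let F₀ : C(Q, E) := ⟨Quotient.lift f (by
      rintro a b ⟨s, rfl⟩
      exact hf s b), f.continuous.quotient_lift _⟩
  let D := TopologicalSpace.denseSeq C(C, ℂ)
  have hD : Dense (range D) := TopologicalSpace.denseRange_denseSeq _
  let I := {p : ℕ × ℕ × ℕ // p.2.1 ≠ 0}
  let A : I → Set C := fun p => fourierSlice (D p.1.1) p.1.2.1 p.1.2.2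
  have hAcl : ∀ p, IsClosed (A p) := fun p => isClosed_fourierSlice _ _ _
  let U : I → Set C(Q, E) := fun p => {F | ∀ a ∈ A p, F (π a) ≠ 0}
  have hUo : ∀ p, IsOpen (U p) := by
    intro p
    have := ContinuousMap.isOpen_setOfPred_mapsTo (X := Q) (Y := E)
      (((hAcl p).isCompact).image π.continuous) (isOpen_compl_singleton (x := (0 : E)))
    convert this using 1
    ext F
    simp [U, MapsTo]
  have hUd : ∀ p, Dense (U p) := by
    intro p
    refine Metric.dense_iff.2 fun F r hr => ?_
    have : CompactSpace (A p) := isCompact_iff_compactSpace.1 (hAcl p).isCompact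
    obtain ⟨t, ht⟩ := exists_measure_range_vadd_fourierSlice_eq_zero (Measure.addHaar : Measure E)
      hι hinj (D p.1.1) p.2 p.1.2.2
    let ιt : A p → E := fun a => ι (t +ᵥ (a : C))
    let FA : C(A p, E) := ⟨fun a => F (π a), by fun_prop⟩
    obtain ⟨g, hg, hg0⟩ := exists_approx_ne_zero_of_addHaar_range_eq_zero
      (Measure.addHaar : Measure E) (ι := ιt) (by fun_prop)
      (hinj.comp ((AddAction.injective t).comp Subtype.val_injective)) ht FA (half_pos hr)
    have hπA : IsClosedEmbedding fun a : A p => π a := by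
      refine Continuous.isClosedEmbedding (by fun_prop) fun a b hab => ?_
      obtain ⟨s, hs⟩ := hπ _ _ hab
      ext
      rw [← hs]
      exact vadd_eq_of_mem_fourierSlice p.2 b.2 (hs ▸ a.2)
    obtain ⟨h, hh, hhe⟩ := exists_extension_norm_le hπA (g - FA) (half_pos hr) (fun a => by
      have := hg a
      rw [dist_eq_norm] at this
      exact this.le)
    refine ⟨F + h, ?_, fun a ha => ?_⟩
    · rw [mem_ball, dist_eq_norm, add_sub_cancel_left]
      exact ((ContinuousMap.norm_le h (half_pos hr).le).2 hh).trans_lt (half_lt_self hr)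
    · have h1 := hhe ⟨a, ha⟩
      have h2 : (F + h) (π a) = g ⟨a, ha⟩ := by
        rw [ContinuousMap.add_apply, h1]
        simp [FA]
      rw [h2]
      exact hg0 _
  obtain ⟨F, hF, hFε⟩ := (dense_iInter_of_isOpen hUo hUd).exists_dist_lt F₀ hε
  refine ⟨F.comp π, fun x => ?_, fun x hx => ?_⟩
  · rw [dist_comm]
    exact (ContinuousMap.dist_apply_le_dist (f := F₀) (g := F) (π x)).trans_lt hFε
  · obtain ⟨φ, ⟨i, rfl⟩, k, j, hk, s, hs⟩ := exists_vadd_mem_fourierSlice (hfix x) hD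
    refine mem_iInter.1 hF ⟨(i, k, j), hk⟩ _ hs ?_
    have : π (s +ᵥ x) = π x := Quotient.sound (s := AddAction.orbitRel UnitAddCircle C) ⟨s, rfl⟩
    rw [this]
    exact hx

/-- The orbit average `a` of a map `e`, and the oscillation `δ` of `e` along orbits. -/
theorem exists_orbit_average {V E : Type*} [AddAction UnitAddCircle V] [TopologicalSpace V]
    [LocallyCompactSpace V] [FirstCountableTopology V] [ContinuousVAdd UnitAddCircle V]
    [NormedAddCommGroup E] [NormedSpace ℝ E] [FiniteDimensional ℝ E]
    {e : V → E} (he : Continuous e) (hinj : Function.Injective e) :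
    ∃ (a : C(V, E)) (δ : C(V, ℝ)), (∀ (s : UnitAddCircle) y, a (s +ᵥ y) = a y) ∧
      (∀ (s : UnitAddCircle) y, δ (s +ᵥ y) = δ y) ∧ (∀ y, ‖e y - a y‖ ≤ δ y) ∧
      (∀ y, δ y ≤ 0 → y ∈ AddAction.fixedPoints UnitAddCircle V) ∧
      ∀ y ∈ AddAction.fixedPoints UnitAddCircle V, a y = e y ∧ δ y = 0 := by
  have := FiniteDimensional.proper ℝ E
  let Γ : C(V, C(UnitAddCircle, E)) :=
    ContinuousMap.curry ⟨fun p => e (p.2 +ᵥ p.1), by fun_prop⟩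
  have hΓ : ∀ y s, Γ y s = e (s +ᵥ y) := fun _ _ => rfl
  let a : C(V, E) := ⟨fun y => ∫ s : UnitAddCircle, e (s +ᵥ y) ∂AddCircle.haarAddCircle, by
    have := continuous_parametric_integral_of_continuous (μ := AddCircle.haarAddCircle)
      (f := fun (y : V) (s : UnitAddCircle) => e (s +ᵥ y))
      (by
        unfold Function.uncurry
        fun_prop) isCompact_univ
    simpa only [setIntegral_univ] using! this⟩
  let δ : C(V, ℝ) := ⟨fun y => ‖Γ y - ContinuousMap.const _ (a y)‖, by
    have : Continuous fun y => ContinuousMap.const UnitAddCircle (a y) :=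
      ContinuousMap.continuous_const'.comp a.continuous
    fun_prop⟩
  have ha : ∀ (s : UnitAddCircle) y, a (s +ᵥ y) = a y := by
    intro t y
    simp only [a, ContinuousMap.coe_mk, vadd_vadd]
    exact integral_add_right_eq_self (fun s : UnitAddCircle => e (s +ᵥ y)) t
  have hδ : ∀ y (s : UnitAddCircle), ‖e (s +ᵥ y) - a y‖ ≤ δ y := fun y s =>
    ContinuousMap.norm_coe_le_norm (Γ y - ContinuousMap.const _ (a y)) s
  have hδle : ∀ y b, 0 ≤ b → (∀ s : UnitAddCircle, ‖e (s +ᵥ y) - a y‖ ≤ b) → δ y ≤ b :=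
    fun y b hb h => (ContinuousMap.norm_le _ hb).2 h
  have hδ0 : ∀ y, 0 ≤ δ y := fun y =>
    norm_nonneg (Γ y - ContinuousMap.const _ (a y))
  have hδinv : ∀ (s : UnitAddCircle) y, δ (s +ᵥ y) ≤ δ y := fun s y =>
    hδle _ _ (hδ0 y) fun t => by rw [ha, vadd_vadd]; exact hδ y _
  refine ⟨a, δ, ha, fun s y => (hδinv s y).antisymm ?_, fun y => ?_, fun y hy s => ?_,
    fun y hy => ?_⟩
  · simpa using hδinv (-s) (s +ᵥ y)
  · simpa using hδ y 0
  · have h1 : ∀ s : UnitAddCircle, e (s +ᵥ y) = a y := fun s =>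
      sub_eq_zero.1 (norm_le_zero_iff.1 ((hδ y s).trans hy))
    apply hinj
    rw [h1, ← h1 0, zero_vadd]
  · have hay : a y = e y := by
      simp only [a, ContinuousMap.coe_mk, hy _]
      simp
    refine ⟨hay, le_antisymm (hδle _ _ le_rfl fun s => ?_) (hδ0 y)⟩
    rw [hy, hay, sub_self, norm_zero]

/-- Gluing a continuous function on an open piece with a constant outside a closed piece. -/
theorem exists_continuous_extension_of_eq_const {V E Y F : Type*} [TopologicalSpace V]
    [TopologicalSpace E] [TopologicalSpace Y] [TopologicalSpace F] {e : V → E}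
    (he : IsOpenEmbedding e) {H : V × Y → F} (hH : Continuous H) {O P : Set V} (hO : IsOpen O)
    (hP : IsClosed (e '' P)) (p : F)
    (hp : ∀ y ∈ O, y ∉ P → ∀ t, H (y, t) = p) (hPO : P ⊆ O) :
    ∃ G : E × Y → F, Continuous G ∧ (∀ y ∈ O, ∀ t, G (e y, t) = H (y, t)) ∧
      ∀ z ∉ e '' O, ∀ t, G (z, t) = p := by
  classical
  rcases isEmpty_or_nonempty V with hV | hV
  · exact ⟨fun _ => p, continuous_const, fun y => isEmptyElim y, fun _ _ _ => rfl⟩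
  let ψ := he.toOpenPartialHomeomorph e
  have hψ : ∀ y, ψ.symm (e y) = y := fun y => ψ.left_inv (by simp [ψ])
  have hOe : IsOpen (e '' O) := he.isOpenMap _ hO
  let G : E × Y → F := fun q => if q.1 ∈ e '' O then H (ψ.symm q.1, q.2) else p
  refine ⟨G, continuous_iff_continuousAt.2 ?_, fun y hy t => ?_, fun z hz t => if_neg hz⟩
  · rintro ⟨z, t⟩
    by_cases hz : z ∈ e '' O
    · have h1 : ContinuousAt (fun q : E × Y => H (ψ.symm q.1, q.2)) (z, t) := by
        refine hH.continuousAt.comp ((ContinuousAt.comp (f := Prod.fst) ?_ continuousAt_fst).prodMk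
          continuousAt_snd)
        refine ψ.continuousAt_symm ?_
        simpa [ψ] using image_subset_range e O hz
      refine h1.congr ?_
      filter_upwards [(hOe.preimage continuous_fst).mem_nhds hz] with q hq
      exact (if_pos hq).symm
    · have hzP : z ∉ e '' P := fun h => hz (image_mono hPO h)
      refine (continuousAt_const (y := p)).congr ?_
      filter_upwards [(hP.isOpen_compl.preimage continuous_fst).mem_nhds hzP] with q hq
      by_cases hqO : q.1 ∈ e '' O
      · obtain ⟨x, t⟩ := q
        obtain ⟨y, hy, rfl⟩ := hqO
        simp only [G, if_pos (mem_image_of_mem e hy), hψ]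
        exact (hp y hy (fun h => hq (mem_image_of_mem e h)) t).symm
      · exact (if_neg hqO).symm
  · simp only [G, if_pos (mem_image_of_mem e hy), hψ]

/-- The radial map `w ↦ (max 0 (2ρ - ‖w‖) • w, min ‖w‖ 2ρ - ρ)`. -/
noncomputable def pinchMap {E : Type*} [NormedAddCommGroup E] [NormedSpace ℝ E] (ρ : ℝ) (w : E) :
    E × ℝ :=
  (max 0 (2 * ρ - ‖w‖) • w, min ‖w‖ (2 * ρ) - ρ)

section PinchMap

variable {E : Type*} [NormedAddCommGroup E] [NormedSpace ℝ E] {ρ : ℝ}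

theorem continuous_pinchMap : Continuous (pinchMap ρ : E → E × ℝ) := by
  unfold pinchMap
  fun_prop

theorem pinchMap_of_le {w : E} (hw : 2 * ρ ≤ ‖w‖) : pinchMap ρ w = (0, ρ) := by
  unfold pinchMap
  rw [max_eq_left (by linarith), min_eq_right hw, zero_smul]
  congr 1
  ring

theorem pinchMap_ne_zero (hρ : 0 < ρ) (w : E) : pinchMap ρ w ≠ 0 := by
  intro h
  rcases le_or_gt (2 * ρ) ‖w‖ with hw | hw
  · rw [pinchMap_of_le hw] at h
    exact hρ.ne' (congrArg Prod.snd h)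
  · have h1 : max 0 (2 * ρ - ‖w‖) • w = 0 := congrArg Prod.fst h
    have h2 : min ‖w‖ (2 * ρ) - ρ = 0 := congrArg Prod.snd h
    rw [max_eq_right (by linarith), smul_eq_zero] at h1
    rcases h1 with h1 | h1
    · linarith
    · rw [h1, norm_zero, min_eq_left (by linarith)] at h2
      linarith

end PinchMap

theorem false_of_fixed_ball_of_not_fixed {V E : Type*} [AddAction UnitAddCircle V]
    [TopologicalSpace V] [ContinuousVAdd UnitAddCircle V]
    [NormedAddCommGroup E] [NormedSpace ℝ E] [FiniteDimensional ℝ E]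
    {e : V → E} (he : IsOpenEmbedding e) {c : E} {r ρ η : ℝ} (hρ : 0 < ρ) (hη : 0 < η)
    (hrange : closedBall c r ⊆ range e) {u v : E}
    (hu : ∀ y, ‖e y - u‖ ≤ 4 * ρ → y ∈ AddAction.fixedPoints UnitAddCircle V)
    (hv : ∀ y ∈ AddAction.fixedPoints UnitAddCircle V, η ≤ ‖e y - v‖)
    (huc : u ∈ closedBall c (r - 4 * ρ)) (hvc : v ∈ closedBall c (r - 4 * ρ)) : False := by
  have := FiniteDimensional.proper ℝ E
  have hVlc : LocallyCompactSpace V := he.locallyCompactSpace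
  have hVm : TopologicalSpace.MetrizableSpace V := he.isEmbedding.metrizableSpace
  obtain ⟨a, δ, ha, hδ, hea, hδfix, hfix⟩ := exists_orbit_average he.continuous he.injective
  let κ : V → ℝ := fun y => max 0 (1 - 2 * δ y / ρ)
  have hκ0 : ∀ y, 0 ≤ κ y := fun y => le_max_left _ _
  have hδ0 : ∀ y, 0 ≤ δ y := fun y => (norm_nonneg _).trans (hea y)
  have hκ1 : ∀ y, κ y ≤ 1 := fun y => max_le zero_le_one (by
    have : 0 ≤ 2 * δ y / ρ := div_nonneg (by linarith [hδ0 y]) hρ.le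
    linarith)
  have hκc : Continuous κ := by fun_prop
  let f : ℝ → V → E := fun t y => a y - (u + (t * κ y) • (v - u))
  have hfc : Continuous fun q : V × ℝ => f q.2 q.1 := by fun_prop
  have hfar : ∀ t y, ρ / 2 ≤ δ y → δ y < ρ → 3 * ρ ≤ ‖f t y‖ := by
    intro t y h1 h2
    have hκy : κ y = 0 := max_eq_left (by
      have : 1 ≤ 2 * δ y / ρ := (one_le_div hρ).2 (by linarith)
      linarith)
    have h3 : 4 * ρ < ‖e y - u‖ := by
      by_contra! h
      have := (hfix y (hu y h)).2
      linarith
    have h4 : f t y = (e y - u) - (e y - a y) := by simp only [f, hκy]; simp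
    rw [h4]
    linarith [norm_sub_norm_le (e y - u) (e y - a y), hea y]
  have hnear : ∀ t ∈ Icc (0 : ℝ) 1, ∀ y, δ y < ρ → ‖f t y‖ ≤ 5 / 2 * ρ →
      ‖e y - c‖ ≤ r - ρ / 2 := by
    intro t ht y h1 h2
    have h3 : u + (t * κ y) • (v - u) ∈ closedBall c (r - 4 * ρ) :=
      (convex_closedBall c (r - 4 * ρ)).add_smul_sub_mem huc hvc
        ⟨mul_nonneg ht.1 (hκ0 y), mul_le_one₀ ht.2 (hκ0 y) (hκ1 y)⟩
    rw [mem_closedBall, dist_eq_norm] at h3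
    have h4 : e y - c = (e y - a y) + f t y + (u + (t * κ y) • (v - u) - c) := by
      simp only [f]; abel
    rw [h4]
    linarith [norm_add₃_le (a := e y - a y) (b := f t y) (c := u + (t * κ y) • (v - u) - c), hea y]
  let P : Set V := {y | ‖e y - c‖ ≤ r - ρ / 2 ∧ δ y ≤ ρ / 2}
  let O : Set V := {y | ‖e y - c‖ < r ∧ δ y < ρ}
  have hec := he.continuous
  have hPcpt : IsCompact P := by
    have : IsCompact (e ⁻¹' closedBall c (r - ρ / 2)) :=
      (he.isInducing.isCompact_preimage_iff
        ((closedBall_subset_closedBall (by linarith)).trans hrange)).2 (isCompact_closedBall _ _)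
    refine this.of_isClosed_subset ?_ fun y hy => by simpa [dist_eq_norm] using hy.1
    have h1 : IsClosed {y | ‖e y - c‖ ≤ r - ρ / 2} := isClosed_le (by fun_prop) continuous_const
    have h2 : IsClosed {y | δ y ≤ ρ / 2} := isClosed_le (by fun_prop) continuous_const
    exact h1.inter h2
  have hO : IsOpen O := by
    have h1 : IsOpen {y | ‖e y - c‖ < r} := isOpen_lt (by fun_prop) continuous_const
    have h2 : IsOpen {y | δ y < ρ} := isOpen_lt (by fun_prop) continuous_const
    exact h1.inter h2
  have hPO : P ⊆ O := fun y hy => ⟨by linarith [hy.1], by linarith [hy.2]⟩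
  have hOP : ∀ t ∈ Icc (0 : ℝ) 1, ∀ y ∈ O, y ∉ P → 5 / 2 * ρ ≤ ‖f t y‖ := by
    intro t ht y hy hyP
    rcases le_or_gt (δ y) (ρ / 2) with h | h
    · by_contra! h1
      exact hyP ⟨hnear t ht y hy.2 h1.le, h⟩
    · linarith [hfar t y h.le hy.2]
  obtain ⟨ε, hε, hερ, hεη⟩ : ∃ ε > 0, ε < 2 * ρ ∧ ε < η :=
    ⟨min (2 * ρ) η / 2, by positivity,
      by linarith [min_le_left (2 * ρ) η, lt_min (show 0 < 2 * ρ by linarith) hη],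
      by linarith [min_le_right (2 * ρ) η, lt_min (show 0 < 2 * ρ by linarith) hη]⟩
  let C : SubAddAction UnitAddCircle V :=
    { carrier := {y | δ y ≤ ρ / 2 ∧ ‖f 1 y‖ ≤ ε}
      vadd_mem' := fun s y hy => by
        simpa only [mem_ofPred_eq, f, κ, ha, hδ] using hy }
  have hf1c : Continuous (f 1) := by fun_prop
  have hCcl : IsClosed (C : Set V) := by
    have h1 : IsClosed {y | δ y ≤ ρ / 2} := isClosed_le (by fun_prop) continuous_const
    have h2 : IsClosed {y | ‖f 1 y‖ ≤ ε} := isClosed_le (by fun_prop) continuous_const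
    exact h1.inter h2
  have hCcpt : CompactSpace C := isCompact_iff_compactSpace.1
    (hPcpt.of_isClosed_subset hCcl fun y hy =>
      ⟨hnear 1 ⟨zero_le_one, le_rfl⟩ y (by linarith [hy.1]) (by linarith [hy.2]), hy.1⟩)
  obtain ⟨g, hg, hg0⟩ := exists_approx_ne_zero_of_vadd_invariant (C := C)
    (fun y => by
      by_contra! h
      have hyfix : (y : V) ∈ AddAction.fixedPoints UnitAddCircle V := fun s =>
        congrArg Subtype.val (h s)
      obtain ⟨h1, h2⟩ := hfix y hyfix
      have h3 := hv y hyfix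
      have h4 : f 1 y = e y - v := by simp [f, κ, h1, h2]
      have h5 : ‖f 1 y‖ ≤ ε := y.2.2
      rw [h4] at h5
      linarith)
    (ι := fun y => e y) (by fun_prop) (he.injective.comp Subtype.val_injective)
    ⟨fun y => f 1 y, by fun_prop⟩
    (fun s y => by
      simp only [ContinuousMap.coe_mk, f, κ, SubAddAction.val_vadd, ha, hδ])
    (ε := ε / 4) (by positivity)
  have hε4 : 0 < ε / 4 := by positivity
  obtain ⟨μ, hμ, hμg⟩ := exists_extension_norm_le hCcl.isClosedEmbedding_subtypeVal
    (g - ⟨fun y => f 1 y, hf1c.comp continuous_subtype_val⟩) hε4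
    (fun y => by
      have := hg y
      rw [dist_eq_norm] at this
      exact this.le)
  have hne : ∀ y ∈ P, f 1 y + μ y ≠ 0 := by
    intro y hy h0
    rcases le_or_gt ‖f 1 y‖ ε with h | h
    · have hyC : y ∈ C := ⟨hy.2, h⟩
      refine hg0 ⟨y, hyC⟩ ?_
      have := hμg ⟨y, hyC⟩
      simp only [ContinuousMap.sub_apply, ContinuousMap.coe_mk] at this
      rw [← h0, this]
      abel
    · have := hμ y
      rw [eq_neg_of_add_eq_zero_left h0, norm_neg] at h
      linarith
  obtain ⟨m, hm, hmP⟩ : ∃ m > 0, ∀ y ∈ P, m ≤ ‖f 1 y + μ y‖ := by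
    rcases P.eq_empty_or_nonempty with hP | hP
    · exact ⟨1, one_pos, by simp [hP]⟩
    · obtain ⟨y₀, hy₀, hmin⟩ := hPcpt.exists_isMinOn hP
        (f := fun y => ‖f 1 y + μ y‖) (by fun_prop)
      exact ⟨_, norm_pos_iff.2 (hne y₀ hy₀), fun y hy => hmin hy⟩
  let K : ℝ := 2 * ρ / m
  have hK : 0 < K := by positivity
  let cl : ℝ → ℝ := fun t => max 0 (min 1 t)
  have hcl : ∀ t, cl t ∈ Icc (0 : ℝ) 1 := fun t =>
    ⟨le_max_left _ _, max_le zero_le_one (min_le_left _ _)⟩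
  let w : ℝ → V → E := fun t y => (1 + K * t) • (f t y + t • μ y)
  have hwP : ∀ t ∈ Icc (0 : ℝ) 1, ∀ y ∈ O, y ∉ P → 2 * ρ ≤ ‖w t y‖ := by
    intro t ht y hy hyP
    have h1 := hOP t ht y hy hyP
    have h2 : ‖t • μ y‖ ≤ ε / 4 := by
      rw [norm_smul, Real.norm_of_nonneg ht.1]
      exact (mul_le_of_le_one_left (norm_nonneg _) ht.2).trans (hμ y)
    have h3 : 2 * ρ ≤ ‖f t y + t • μ y‖ := by
      have := norm_sub_le_norm_add (f t y) (t • μ y)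
      linarith
    have h4 : 0 ≤ K * t := mul_nonneg hK.le ht.1
    simp only [w, norm_smul]
    rw [Real.norm_of_nonneg (by linarith)]
    nlinarith
  have hw1 : ∀ y ∈ O, 2 * ρ ≤ ‖w 1 y‖ := by
    intro y hy
    by_cases hyP : y ∈ P
    · simp only [w, norm_smul, mul_one, one_smul]
      rw [Real.norm_of_nonneg (by linarith)]
      have h1 := hmP y hyP
      have h2 : K * m = 2 * ρ := div_mul_cancel₀ _ hm.ne'
      nlinarith
    · exact hwP 1 ⟨zero_le_one, le_rfl⟩ y hy hyP
  obtain ⟨G, hGc, hGO, hGout⟩ := exists_continuous_extension_of_eq_const (Y := ℝ) he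
    (H := fun q => pinchMap ρ (w (cl q.2) q.1))
    (continuous_pinchMap.comp (by
      have : Continuous fun q : V × ℝ => f (cl q.2) q.1 :=
        hfc.comp (f := fun q : V × ℝ => (q.1, cl q.2)) (by fun_prop)
      fun_prop))
    hO (hPcpt.image hec).isClosed (0, ρ)
    (fun y hy hyP t => pinchMap_of_le (hwP _ (hcl t) y hy hyP)) hPO
  have hr : 4 * ρ ≤ r := by
    have := nonempty_closedBall.1 ⟨u, huc⟩
    linarith
  rw [mem_closedBall, dist_eq_norm] at huc
  have hGne : ∀ x, G x ≠ 0 := by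
    rintro ⟨z, t⟩
    by_cases hz : z ∈ e '' O
    · obtain ⟨y, hy, rfl⟩ := hz
      rw [hGO y hy]
      exact pinchMap_ne_zero hρ _
    · rw [hGout z hz]
      intro h
      exact hρ.ne' (congrArg Prod.snd h)
  obtain ⟨y₀, hy₀⟩ : ∃ y, e y = u :=
    hrange (by rw [mem_closedBall, dist_eq_norm]; linarith)
  have hy₀O : y₀ ∈ O := by
    refine ⟨by rw [hy₀]; linarith, ?_⟩
    rw [(hfix y₀ (hu y₀ (by rw [hy₀, sub_self, norm_zero]; linarith))).2]
    exact hρ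
  obtain ⟨x, hx⟩ := exists_eq_zero_of_ne_neg_smul hGc (u, (1 / 2 : ℝ)) (R := 2 * r + 1) (by
    rintro ⟨z, t⟩ hzt b hb heq
    have key : G (z, t) = (0, ρ) → z = u ∧ ρ = b * (1 / 2 - t) := by
      intro h
      rw [h] at heq
      have h1 : 0 = -(b • (z - u)) := congrArg Prod.fst heq
      have h2 : ρ = -(b * (t - 1 / 2)) := congrArg Prod.snd heq
      have hb0 : b ≠ 0 := by rintro rfl; simp at h2; exact hρ.ne' h2
      refine ⟨?_, by linarith⟩
      have h3 := (smul_eq_zero.1 (neg_eq_zero.1 h1.symm)).resolve_left hb0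
      exact sub_eq_zero.1 h3
    by_cases hz : z ∈ e '' O
    swap
    · obtain ⟨rfl, -⟩ := key (hGout z hz t)
      exact hz ⟨y₀, hy₀O, hy₀⟩
    obtain ⟨y, hy, rfl⟩ := hz
    rcases le_or_gt 1 t with ht | ht
    · have : cl t = 1 := by simp only [cl]; rw [min_eq_left ht, max_eq_right zero_le_one]
      obtain ⟨-, h⟩ := key (by rw [hGO y hy, this]; exact pinchMap_of_le (hw1 y hy))
      nlinarith
    rcases le_or_gt t 0 with ht' | ht'
    · have h0 : cl t = 0 := by simp only [cl]; rw [min_eq_right (by linarith), max_eq_left ht']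
      have hw0 : w 0 y = a y - u := by simp [w, f]
      have hG := hGO y hy t
      rw [h0, hw0] at hG
      rcases le_or_gt (2 * ρ) ‖a y - u‖ with h | h
      · obtain ⟨h1, -⟩ := key (hG.trans (pinchMap_of_le h))
        have hyf := (hfix y (hu y (by rw [h1, sub_self, norm_zero]; linarith))).1
        rw [hyf, h1, sub_self, norm_zero] at h
        linarith
      · have h1 : ‖e y - u‖ ≤ 4 * ρ := by
          have h2 : e y - u = (e y - a y) + (a y - u) := by abel
          rw [h2]
          linarith [norm_add_le (e y - a y) (a y - u), hea y, hy.2]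
        rw [(hfix y (hu y h1)).1] at h hG
        rw [hG] at heq
        have h2 : max 0 (2 * ρ - ‖e y - u‖) • (e y - u) = -(b • (e y - u)) := congrArg Prod.fst heq
        have h3 : min ‖e y - u‖ (2 * ρ) - ρ = -(b * (t - 1 / 2)) := congrArg Prod.snd heq
        rw [max_eq_right (by linarith), ← sub_eq_zero, sub_neg_eq_add, ← add_smul,
          smul_eq_zero] at h2
        rcases h2 with h2 | h2
        · linarith
        · rw [h2, norm_zero, min_eq_left (by linarith)] at h3
          nlinarith
    · have h1 : ‖(e y, t) - (u, (1 / 2 : ℝ))‖ < 2 * r + 1 := by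
        rw [Prod.mk_sub_mk, Prod.norm_mk, max_lt_iff, Real.norm_eq_abs, abs_lt]
        refine ⟨?_, by linarith, by linarith⟩
        have h2 : e y - u = (e y - c) - (u - c) := by abel
        rw [h2]
        linarith [norm_sub_le (e y - c) (u - c), hy.1]
      linarith)
  exact hGne x hx

/-- Local form of Newman's theorem for circle actions. -/
theorem preimage_ball_subset_fixedPoints {V E : Type*} [AddAction UnitAddCircle V]
    [TopologicalSpace V] [ContinuousVAdd UnitAddCircle V]
    [NormedAddCommGroup E] [NormedSpace ℝ E] [FiniteDimensional ℝ E]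
    {e : V → E} (he : IsOpenEmbedding e) {c : E} {r : ℝ} (hrange : closedBall c r ⊆ range e)
    (hint : (interior (AddAction.fixedPoints UnitAddCircle V) ∩ e ⁻¹' ball c r).Nonempty) :
    e ⁻¹' ball c r ⊆ AddAction.fixedPoints UnitAddCircle V := by
  have hT2 : T2Space V := T2Space.of_injective_continuous he.injective he.continuous
  obtain ⟨u', hu', huc⟩ := hint
  intro v' hvc
  by_contra hv'
  have hcl : IsClosed (AddAction.fixedPoints UnitAddCircle V) := by
    have : AddAction.fixedPoints UnitAddCircle V = ⋂ s : UnitAddCircle, {y | s +ᵥ y = y} := by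
      ext; simp [AddAction.fixedPoints]
    rw [this]
    exact isClosed_iInter fun s => isClosed_eq (by fun_prop) continuous_id
  obtain ⟨η, hη, hηs⟩ := Metric.isOpen_iff.1 (he.isOpenMap _ hcl.isOpen_compl) (e v') ⟨v', hv', rfl⟩
  obtain ⟨θ, hθ, hθs⟩ := Metric.isOpen_iff.1 (he.isOpenMap _ isOpen_interior) (e u') ⟨u', hu', rfl⟩
  rw [mem_preimage, mem_ball] at huc hvc
  obtain ⟨ρ, hρ, h1, h2, h3⟩ : ∃ ρ > 0, 4 * ρ < θ ∧ 4 * ρ ≤ r - dist (e u') c ∧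
      4 * ρ ≤ r - dist (e v') c := by
    have hm : 0 < min θ (min (r - dist (e u') c) (r - dist (e v') c)) :=
      lt_min hθ (lt_min (by linarith) (by linarith))
    refine ⟨min θ (min (r - dist (e u') c) (r - dist (e v') c)) / 8, by positivity, ?_, ?_, ?_⟩
    · linarith [min_le_left θ (min (r - dist (e u') c) (r - dist (e v') c))]
    · linarith [(min_le_right θ (min (r - dist (e u') c) (r - dist (e v') c))).trans
        (min_le_left _ _)]
    · linarith [(min_le_right θ (min (r - dist (e u') c) (r - dist (e v') c))).trans
        (min_le_right _ _)]
  refine false_of_fixed_ball_of_not_fixed he hρ hη hrange (u := e u') (v := e v') (fun y hy => ?_)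
    (fun y hy => ?_) (by rw [mem_closedBall]; linarith) (by rw [mem_closedBall]; linarith)
  · obtain ⟨x, hx, hxy⟩ := hθs (show e y ∈ ball (e u') θ by
      rw [mem_ball, dist_eq_norm]; linarith)
    exact he.injective hxy ▸ interior_subset hx
  · by_contra! h
    obtain ⟨x, hx, hxy⟩ := hηs (show e y ∈ ball (e v') η by rwa [mem_ball, dist_eq_norm])
    exact hx (he.injective hxy ▸ hy)

/-- Newman's theorem for circle actions: on a connected manifold, a circle action whose fixed point
set has nonempty interior is trivial. -/
theorem fixedPoints_eq_univ_of_interior_nonempty {X E : Type*} [TopologicalSpace X] [T2Space X]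
    [PreconnectedSpace X] [NormedAddCommGroup E] [NormedSpace ℝ E] [FiniteDimensional ℝ E]
    [ChartedSpace E X] [AddAction UnitAddCircle X] [ContinuousVAdd UnitAddCircle X]
    (h : (interior (AddAction.fixedPoints UnitAddCircle X)).Nonempty) :
    AddAction.fixedPoints UnitAddCircle X = univ := by
  have hcl : IsClosed (AddAction.fixedPoints UnitAddCircle X) := by
    have : AddAction.fixedPoints UnitAddCircle X = ⋂ s : UnitAddCircle, {y | s +ᵥ y = y} := by
      ext; simp [AddAction.fixedPoints]
    rw [this]
    exact isClosed_iInter fun s => isClosed_eq (by fun_prop) continuous_id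
  suffices hc : IsClosed (interior (AddAction.fixedPoints UnitAddCircle X)) from
    univ_subset_iff.1 ((IsClopen.eq_univ ⟨hc, isOpen_interior⟩ h).ge.trans interior_subset)
  refine isClosed_of_closure_subset fun x hx => ?_
  have hxf : x ∈ AddAction.fixedPoints UnitAddCircle X :=
    closure_minimal interior_subset hcl hx
  let φ := chartAt E x
  let V : SubAddAction UnitAddCircle X :=
    { carrier := {y | ∀ s : UnitAddCircle, s +ᵥ y ∈ φ.source}
      vadd_mem' := fun s y hy t => by rw [vadd_vadd]; exact hy _ }
  have hVo : IsOpen (V : Set X) := by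
    have h1 : IsClosed {q : UnitAddCircle × X | q.1 +ᵥ q.2 ∉ φ.source} :=
      φ.open_source.isClosed_compl.preimage continuous_vadd
    have h2 := isClosedMap_snd_of_compactSpace _ h1
    have h3 : (V : Set X) = (Prod.snd '' {q : UnitAddCircle × X | q.1 +ᵥ q.2 ∉ φ.source})ᶜ := by
      ext y
      change (∀ s : UnitAddCircle, s +ᵥ y ∈ φ.source) ↔ _
      simp
    rw [h3]
    exact h2.isOpen_compl
  have hVs : (V : Set X) ⊆ φ.source := fun y hy => by simpa using hy 0
  have hxV : x ∈ V := fun s => by rw [hxf s]; exact mem_chart_source E x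
  let e : V → E := fun y => φ y
  have he : IsOpenEmbedding e := by
    refine .of_continuous_injective_isOpenMap ?_ ?_ ?_
    · exact φ.continuousOn.comp_continuous continuous_subtype_val fun y => hVs y.2
    · exact fun y z hyz => Subtype.ext (φ.injOn (hVs y.2) (hVs z.2) hyz)
    · intro U hU
      have h1 := φ.isOpen_image_of_subset_source (hVo.isOpenMap_subtype_val U hU)
        (by rintro _ ⟨y, -, rfl⟩; exact hVs y.2)
      rwa [image_image] at h1
  obtain ⟨r, hr, hrs⟩ := Metric.nhds_basis_closedBall.mem_iff.1
    (he.isOpen_range.mem_nhds ⟨(⟨x, hxV⟩ : V), rfl⟩)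
  have hO : IsOpen ((↑) '' (e ⁻¹' ball (φ x) r) : Set X) :=
    hVo.isOpenMap_subtype_val _ (isOpen_ball.preimage he.continuous)
  have hxO : x ∈ ((↑) '' (e ⁻¹' ball (φ x) r) : Set X) := ⟨⟨x, hxV⟩, mem_ball_self hr, rfl⟩
  obtain ⟨_, ⟨y, hy, rfl⟩, hyf⟩ := mem_closure_iff.1 hx _ hO hxO
  have hsub : e ⁻¹' ball (φ x) r ⊆ AddAction.fixedPoints UnitAddCircle V := by
    refine preimage_ball_subset_fixedPoints he hrs ⟨y, ?_, hy⟩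
    refine mem_interior.2 ⟨((↑) : V → X) ⁻¹' interior (AddAction.fixedPoints UnitAddCircle X), ?_,
      isOpen_interior.preimage continuous_subtype_val, hyf⟩
    exact fun z hz s => Subtype.ext (interior_subset hz s)
  refine mem_interior.2 ⟨_, ?_, hO, hxO⟩
  rintro _ ⟨z, hz, rfl⟩ s
  exact congrArg Subtype.val (hsub hz s)

/-- A closed nondiscrete additive subgroup of a finite-dimensional real space contains a line. -/
theorem AddSubgroup.exists_line_of_isClosed {E : Type*} [NormedAddCommGroup E] [NormedSpace ℝ E]
    [FiniteDimensional ℝ E] {L : AddSubgroup E} (hL : IsClosed (L : Set E))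
    (h : ∀ ε > 0, ∃ v ∈ L, ‖v‖ < ε ∧ v ≠ 0) : ∃ w ≠ 0, ∀ t : ℝ, t • w ∈ L := by
  have := FiniteDimensional.proper ℝ E
  choose v hvL hv hv0 using fun k : ℕ => h (1 / ((k : ℝ) + 1)) (by positivity)
  have hpos : ∀ k, 0 < ‖v k‖ := fun k => norm_pos_iff.2 (hv0 k)
  have hlim : Tendsto (fun k => ‖v k‖) atTop (𝓝 0) :=
    squeeze_zero (fun k => norm_nonneg _) (fun k => (hv k).le)
      tendsto_one_div_add_atTop_nhds_zero_nat
  obtain ⟨w, hw, φ, hφ, hφw⟩ := (isCompact_sphere (0 : E) 1).tendsto_subseq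
    (x := fun k => ‖v k‖⁻¹ • v k) (fun k => by
      rw [mem_sphere_zero_iff_norm, norm_smul, norm_inv, norm_norm, inv_mul_cancel₀ (hpos k).ne'])
  refine ⟨w, ?_, fun t => ?_⟩
  · rintro rfl
    simp at hw
  have h1 : Tendsto (fun k => (⌊t / ‖v (φ k)‖⌋ : ℝ) * ‖v (φ k)‖) atTop (𝓝 t) := by
    have h2 := hlim.comp hφ.tendsto_atTop
    refine tendsto_of_tendsto_of_tendsto_of_le_of_le (g := fun k => t - ‖v (φ k)‖)
      (h := fun _ => t) (by simpa using h2.const_sub t) tendsto_const_nhds (fun k => ?_)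
      (fun k => ?_)
    · have h3 := Int.sub_one_lt_floor (t / ‖v (φ k)‖)
      have h4 : t = t / ‖v (φ k)‖ * ‖v (φ k)‖ := (div_mul_cancel₀ _ (hpos _).ne').symm
      change t - ‖v (φ k)‖ ≤ _
      nlinarith [hpos (φ k)]
    · exact (mul_le_mul_of_nonneg_right (Int.floor_le _) (hpos _).le).trans_eq
        (div_mul_cancel₀ _ (hpos _).ne')
  refine hL.mem_of_tendsto (h1.smul hφw) (Eventually.of_forall fun k => ?_)
  have h5 : ((⌊t / ‖v (φ k)‖⌋ : ℝ) * ‖v (φ k)‖) • (‖v (φ k)‖⁻¹ • v (φ k)) =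
      ⌊t / ‖v (φ k)‖⌋ • v (φ k) := by
    rw [smul_smul, mul_assoc, mul_inv_cancel₀ (hpos _).ne', mul_one, Int.cast_smul_eq_zsmul]
  change ((⌊t / ‖v (φ k)‖⌋ : ℝ) * ‖v (φ k)‖) • (‖v (φ k)‖⁻¹ • v (φ k)) ∈ L
  rw [h5]
  exact L.zsmul_mem (hvL _) _

/-- A closed additive subgroup containing sufficiently many vectors `b i` is either discrete or
contains the line through a nontrivial integral combination of the `b i`. -/
theorem AddSubgroup.discrete_or_exists_integral_line {E ι : Type*} [NormedAddCommGroup E]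
    [InnerProductSpace ℝ E] [FiniteDimensional ℝ E] [Fintype ι] {L : AddSubgroup E}
    (hL : IsClosed (L : Set E)) {b : ι → E} (hb : ∀ i, b i ∈ L)
    (hι : Module.finrank ℝ E ≤ Fintype.card ι) :
    (∃ ε > 0, ∀ v ∈ L, ‖v‖ < ε → v = 0) ∨
      ∃ g : ι → ℤ, g ≠ 0 ∧ ∀ t : ℝ, t • ∑ i, g i • b i ∈ L := by
  refine or_iff_not_imp_left.2 fun hnd => ?_
  push Not at hnd
  let W : Submodule ℝ E :=
    { carrier := {v | ∀ t : ℝ, t • v ∈ L}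
      add_mem' := fun hu hv t => by rw [smul_add]; exact L.add_mem (hu t) (hv t)
      zero_mem' := fun t => by rw [smul_zero]; exact L.zero_mem
      smul_mem' := fun c v hv t => by rw [smul_smul]; exact hv _ }
  have hWL : ∀ w ∈ W, w ∈ L := fun w hw => by simpa using hw 1
  obtain ⟨w, hw0, hw⟩ := exists_line_of_isClosed hL hnd
  have hlt : Module.finrank ℝ Wᗮ < Module.finrank ℝ E := by
    have h1 := W.finrank_add_finrank_orthogonal
    have h2 : 0 < Module.finrank ℝ W := Module.finrank_pos_iff_exists_ne_zero.2
      ⟨⟨w, hw⟩, fun h => hw0 (congrArg Subtype.val h)⟩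
    omega
  let P : E →ₗ[ℝ] E := (Wᗮ.starProjection : E →L[ℝ] E)
  have hPW : ∀ x, P x ∈ Wᗮ := fun x => Wᗮ.starProjection_apply_mem x
  have hsub : ∀ x, x - P x ∈ W := fun x => by
    have := Wᗮ.sub_starProjection_mem_orthogonal x
    rwa [Submodule.orthogonal_orthogonal] at this
  have hPL : ∀ x ∈ L, P x ∈ L := fun x hx => by
    have := L.sub_mem hx (hWL _ (hsub x))
    rwa [sub_sub_cancel] at this
  let D : AddSubgroup E := L ⊓ Wᗮ.toAddSubgroup
  have hD : ∃ ε > 0, ∀ v ∈ D, ‖v‖ < ε → v = 0 := by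
    by_contra! h
    obtain ⟨u, hu0, hu⟩ := exists_line_of_isClosed (L := D)
      (hL.inter Wᗮ.closed_of_finiteDimensional) h
    have h1 : u ∈ W := fun t => (hu t).1
    have h2 : u ∈ Wᗮ := by simpa using (hu 1).2
    exact hu0 ((Submodule.disjoint_def.1 W.orthogonal_disjoint) u h1 h2)
  obtain ⟨ε, hε, hεD⟩ := hD
  have hspan : ∀ x ∈ Submodule.span ℤ (range fun i => P (b i)), x ∈ D := by
    intro x hx
    induction hx using Submodule.span_induction with
    | mem x hx => obtain ⟨i, rfl⟩ := hx; exact ⟨hPL _ (hb i), hPW _⟩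
    | zero => exact D.zero_mem
    | add x y _ _ hx hy => exact D.add_mem hx hy
    | smul c x _ hx => exact D.zsmul_mem hx c
  have hdisc : DiscreteTopology (Submodule.span ℤ (range fun i => P (b i))) := by
    refine discreteTopology_of_isOpen_singleton_zero ?_
    rw [Metric.isOpen_iff]
    rintro _ rfl
    refine ⟨ε, hε, fun y hy => Subtype.ext (hεD y (hspan y y.2) ?_)⟩
    simpa [dist_eq_norm] using hy
  have hdep : ¬ LinearIndependent ℤ fun i => P (b i) := by
    intro hli
    have h1 := finrank_span_eq_card hli
    have h2 := Real.finrank_eq_int_finrank_of_discrete hdisc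
    have h3 : Set.finrank ℝ (range fun i => P (b i)) ≤ Module.finrank ℝ Wᗮ :=
      Submodule.finrank_mono (Submodule.span_le.2 (by rintro _ ⟨i, rfl⟩; exact hPW _))
    have h4 : Set.finrank ℤ (range fun i => P (b i)) = Fintype.card ι := h1
    omega
  obtain ⟨g, hg, i, hi⟩ := Fintype.not_linearIndependent_iff.1 hdep
  refine ⟨g, fun h => hi (congrFun h i), ?_⟩
  have h1 := hsub (∑ i, g i • b i)
  have h2 : P (∑ i, g i • b i) = 0 := by
    rw [map_sum, ← hg]
    exact Finset.sum_congr rfl fun i _ => map_zsmul P _ _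
  rw [h2, sub_zero] at h1
  exact h1

/-- Newman's theorem for a one-parameter circle subgroup of an acting group. -/
theorem forall_vadd_eq_of_interior_nonempty {G X E : Type*} [AddGroup G] [TopologicalSpace G]
    [TopologicalSpace X] [T2Space X] [PreconnectedSpace X] [NormedAddCommGroup E] [NormedSpace ℝ E]
    [FiniteDimensional ℝ E] [ChartedSpace E X] [AddAction G X] [ContinuousVAdd G X]
    {ψ : UnitAddCircle →+ G} (hψ : Continuous ψ)
    (h : (interior {x : X | ∀ s, ψ s +ᵥ x = x}).Nonempty) (s : UnitAddCircle) (x : X) :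
    ψ s +ᵥ x = x := by
  let _ : AddAction UnitAddCircle X := AddAction.compHom X ψ
  have : ContinuousVAdd UnitAddCircle X :=
    ⟨(hψ.comp continuous_fst).vadd continuous_snd⟩
  exact (fixedPoints_eq_univ_of_interior_nonempty (E := E) h).ge (mem_univ x) s

/-- The covering homomorphism from Euclidean space onto the torus. -/
def euclideanToTorus (m : ℕ) : EuclideanSpace ℝ (Fin m) →+ (Fin m → UnitAddCircle) where
  toFun v i := (v i : UnitAddCircle)
  map_zero' := by ext; simp
  map_add' _ _ := by ext; simp

theorem continuous_euclideanToTorus (m : ℕ) : Continuous (euclideanToTorus m) :=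
  continuous_pi fun i => (AddCircle.continuous_mk' (1 : ℝ)).comp (by fun_prop)

/-- The circle subgroup of the torus with integral direction `g`. -/
def circleToTorus {m : ℕ} (g : Fin m → ℤ) : UnitAddCircle →+ (Fin m → UnitAddCircle) where
  toFun s i := g i • s
  map_zero' := by ext; simp
  map_add' _ _ := by ext; simp

theorem continuous_circleToTorus {m : ℕ} (g : Fin m → ℤ) : Continuous (circleToTorus g) :=
  continuous_pi fun i => continuous_zsmul (g i)

theorem eq_zero_of_circleToTorus_eq_zero {m : ℕ} {g : Fin m → ℤ}
    (h : ∀ s, circleToTorus g s = 0) : g = 0 := by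
  ext i
  by_contra hi
  have hi' : (g i : ℝ) ≠ 0 := Int.cast_ne_zero.2 hi
  have h1 : g i • ((1 / (2 * g i) : ℝ) : UnitAddCircle) = 0 := congrFun (h _) i
  rw [← AddCircle.coe_zsmul, AddCircle.coe_eq_zero_iff] at h1
  obtain ⟨k, hk⟩ := h1
  have h2 : (2 * k : ℝ) = 1 := by
    rw [zsmul_eq_mul, zsmul_eq_mul] at hk
    field_simp at hk
    linarith
  have h3 : 2 * k = 1 := by exact_mod_cast h2
  omega

theorem euclideanToTorus_smul_sum {m : ℕ} (g : Fin m → ℤ) (t : ℝ) :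
    euclideanToTorus m (t • ∑ i, g i • EuclideanSpace.single i (1 : ℝ)) =
      circleToTorus g (t : UnitAddCircle) := by
  ext i
  change ((t • ∑ j, g j • EuclideanSpace.single j (1 : ℝ) : EuclideanSpace ℝ (Fin m)) i :
    UnitAddCircle) = g i • (t : UnitAddCircle)
  rw [← AddCircle.coe_zsmul]
  congr 1
  simp [Pi.single_apply, mul_comm]

theorem euclideanToTorus_single (m : ℕ) (i : Fin m) :
    euclideanToTorus m (EuclideanSpace.single i 1) = 0 := by
  ext j
  change ((EuclideanSpace.single i (1 : ℝ) : EuclideanSpace ℝ (Fin m)) j : UnitAddCircle) = 0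
  rw [AddCircle.coe_eq_zero_iff]
  by_cases h : j = i
  · exact ⟨1, by simp [h]⟩
  · exact ⟨0, by simp [h]⟩

/-- If an `m`-dimensional torus acts continuously and effectively on a connected
topological `n`-manifold `X`, then `m ≤ n`. -/
theorem stmt14 (m n : ℕ) (X : Type) [TopologicalSpace X] [T2Space X] [ConnectedSpace X]
    [ChartedSpace (EuclideanSpace ℝ (Fin n)) X]
    [AddAction (Fin m → AddCircle (1 : ℝ)) X]
    [ContinuousVAdd (Fin m → AddCircle (1 : ℝ)) X]
    (heff : ∀ g : Fin m → AddCircle (1 : ℝ), (∀ x : X, g +ᵥ x = x) → g = 0) :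
    m ≤ n := by
  have : LocallyCompactSpace X :=
    ChartedSpace.locallyCompactSpace (EuclideanSpace ℝ (Fin n)) X
  obtain ⟨x, hx⟩ : ∃ x : X, ∀ g : Fin m → ℤ, g ≠ 0 → ∃ s, circleToTorus g s +ᵥ x ≠ x := by
    by_contra! h
    obtain ⟨⟨g, hg⟩, hgi⟩ := nonempty_interior_of_iUnion_of_closed
      (f := fun g : {g : Fin m → ℤ // g ≠ 0} => {x : X | ∀ s, circleToTorus g.1 s +ᵥ x = x})
      (fun g => by
        simp only [ofPred_forall]
        exact isClosed_iInter fun s => isClosed_eq (by fun_prop) continuous_id)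
      (eq_univ_of_forall fun x => by
        obtain ⟨g, hg, hgx⟩ := h x
        exact mem_iUnion.2 ⟨⟨g, hg⟩, hgx⟩)
    exact hg (eq_zero_of_circleToTorus_eq_zero fun s => heff _
      (forall_vadd_eq_of_interior_nonempty (E := EuclideanSpace ℝ (Fin n))
        (continuous_circleToTorus g) hgi s))
  let L : AddSubgroup (EuclideanSpace ℝ (Fin m)) :=
    (AddAction.stabilizer (Fin m → UnitAddCircle) x).comap (euclideanToTorus m)
  have hπ := continuous_euclideanToTorus m
  have hL : IsClosed (L : Set (EuclideanSpace ℝ (Fin m))) :=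
    isClosed_eq (f := fun v => euclideanToTorus m v +ᵥ x) (g := fun _ => x) (by fun_prop)
      continuous_const
  rcases L.discrete_or_exists_integral_line hL (b := fun i => EuclideanSpace.single i 1)
    (fun i => by
      change euclideanToTorus m _ +ᵥ x = x
      rw [euclideanToTorus_single, zero_vadd]) (by simp) with ⟨ε, hε, hεL⟩ | ⟨g, hg, hgL⟩
  swap
  · obtain ⟨s, hs⟩ := hx g hg
    obtain ⟨t, rfl⟩ := QuotientAddGroup.mk_surjective s
    have h : euclideanToTorus m _ +ᵥ x = x := hgL t
    rw [euclideanToTorus_smul_sum] at h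
    exact absurd h hs
  let φ := chartAt (EuclideanSpace ℝ (Fin n)) x
  have hc : Continuous fun v => euclideanToTorus m v +ᵥ x := by fun_prop
  obtain ⟨δ, hδ, hδφ⟩ := Metric.nhds_basis_closedBall.mem_iff.1
    ((φ.open_source.preimage hc).mem_nhds (x := 0) (by
      rw [mem_preimage, map_zero, zero_vadd]
      exact mem_chart_source _ x))
  have hρ : 0 < min δ (ε / 4) := lt_min hδ (by linarith)
  have hρφ : ∀ v ∈ closedBall (0 : EuclideanSpace ℝ (Fin m)) (min δ (ε / 4)),
      euclideanToTorus m v +ᵥ x ∈ φ.source := fun v hv =>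
    hδφ (closedBall_subset_closedBall (min_le_left _ _) hv)
  have := finrank_le_of_continuousOn_injOn_closedBall hρ
    (φ := fun v => φ (euclideanToTorus m v +ᵥ x))
    (φ.continuousOn.comp hc.continuousOn hρφ) (fun u hu v hv huv => by
      have h1 : euclideanToTorus m u +ᵥ x = euclideanToTorus m v +ᵥ x :=
        φ.injOn (hρφ u hu) (hρφ v hv) huv
      refine sub_eq_zero.1 (hεL _ ?_ ?_)
      · change euclideanToTorus m (u - v) +ᵥ x = x
        rw [map_sub, sub_eq_neg_add, add_vadd, h1, neg_vadd_vadd]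
      · rw [mem_closedBall_zero_iff] at hu hv
        linarith [norm_sub_le u v, min_le_right δ (ε / 4)])
  simpa using this
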